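/- arXiv:1906.00385 — 3 statements merged into one kernel-verified Lean document; each statement's English description precedes it below -/
import Mathlib

section
/- For every λ ∈ K and every s ∈ ℕ_+, the 𝕀_1-module M(s,λ) = 𝕀_1/(F + 𝕀_1(H−λ)^s) is a generalized weight 𝕀_1-module with Supp(M(s,λ)) = λ + ℤ, and dim_K M(s,λ)^{λ+i} = s for every i ∈ ℤ. -/
set_option maxHeartbeats 1000000
set_option synthInstance.maxHeartbeats 400000
set_option linter.unusedSectionVars false

namespace IDO

open scoped TensorProduct

noncomputable section

variable (K : Type*) [Field K] [CharZero K] (n : ℕ)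

/-- The polynomial algebra `P_n = K[x_1, …, x_n]`. -/
abbrev P := MvPolynomial (Fin n) K

/-- The multiplication operator `x_i`. -/
def xOp (i : Fin n) : Module.End K (P K n) := LinearMap.mulLeft K (MvPolynomial.X i)

/-- The partial derivative `∂_i`. -/
def dOp (i : Fin n) : Module.End K (P K n) := (MvPolynomial.pderiv i).toLinearMap

/-- The integration operator `∫_i`, sending `x^α ↦ x^{α+e_i}/(α_i+1)`. -/
def intOp (i : Fin n) : Module.End K (P K n) :=
  ((MvPolynomial.basisMonomials (Fin n) K).constr K)
    (fun α => (((α i : ℕ) : K) + 1)⁻¹ •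
      (MvPolynomial.monomial (α + Finsupp.single i 1) (1 : K)))

/-- The algebra of polynomial integro-differential operators `𝕀_n`, as a subalgebra of
`End_K(P_n)` generated by the `x_i`, `∂_i` and `∫_i`. -/
def InSub : Subalgebra K (Module.End K (P K n)) :=
  Algebra.adjoin K (Set.range (xOp K n) ∪ Set.range (dOp K n) ∪ Set.range (intOp K n))

/-- The algebra `𝕀_n` (as a type, with its canonical ring structure). -/
def In : Type _ := InSub K n

instance : Ring (In K n) := inferInstanceAs (Ring (InSub K n))
instance : Algebra K (In K n) := inferInstanceAs (Algebra K (InSub K n))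
instance : Module (In K n) (P K n) := inferInstanceAs (Module (InSub K n) (P K n))
instance : IsScalarTower K (In K n) (P K n) :=
  inferInstanceAs (IsScalarTower K (InSub K n) (P K n))

/-- `x_i` as an element of `𝕀_n`. -/
def xEl (i : Fin n) : In K n :=
  show InSub K n from
    ⟨xOp K n i, Algebra.subset_adjoin (Set.mem_union_left _ (Set.mem_union_left _ ⟨i, rfl⟩))⟩

/-- `∂_i` as an element of `𝕀_n`. -/
def dEl (i : Fin n) : In K n :=
  show InSub K n from
    ⟨dOp K n i, Algebra.subset_adjoin (Set.mem_union_left _ (Set.mem_union_right _ ⟨i, rfl⟩))⟩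

/-- `∫_i` as an element of `𝕀_n`. -/
def intEl (i : Fin n) : In K n :=
  show InSub K n from
    ⟨intOp K n i, Algebra.subset_adjoin (Set.mem_union_right _ ⟨i, rfl⟩)⟩

/-- `H_i = ∂_i x_i` as an element of `𝕀_n`. -/
def HEl (i : Fin n) : In K n := dEl K n i * xEl K n i

section Modules

variable (M : Type*) [AddCommGroup M] [Module K M] [Module (In K n) M]
  [IsScalarTower K (In K n) M]

/-- The weight space `M_λ = {m | H_i m = λ_i m for all i}`. -/
def weightSpace (lam : Fin n → K) : Submodule K M where
  carrier := {m | ∀ i, HEl K n i • m = lam i • m}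
  add_mem' := by
    intro a b ha hb i
    rw [smul_add, ha i, hb i, smul_add]
  zero_mem' := by intro i; simp
  smul_mem' := by
    intro c m hm i
    rw [← smul_comm c (HEl K n i) m, hm i, smul_smul, mul_comm, ← smul_smul]

private lemma pow_smul_zero_mono {a : In K n} {m : M} {s s' : ℕ}
    (h : (a ^ s) • m = 0) (hle : s ≤ s') : (a ^ s') • m = 0 := by
  obtain ⟨k, rfl⟩ := Nat.exists_eq_add_of_le hle
  rw [add_comm s k, pow_add, mul_smul, h, smul_zero]

/-- The generalized weight space `M^λ = {m | (H_i − λ_i)^N m = 0 for some N and all i}`. -/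
def genWeightSpace (lam : Fin n → K) : Submodule K M where
  carrier := {m | ∃ N : ℕ, ∀ i,
    ((HEl K n i - algebraMap K (In K n) (lam i)) ^ N) • m = 0}
  add_mem' := by
    rintro a b ⟨Na, ha⟩ ⟨Nb, hb⟩
    refine ⟨Na ⊔ Nb, fun i => ?_⟩
    rw [smul_add, pow_smul_zero_mono K n M (ha i) le_sup_left,
      pow_smul_zero_mono K n M (hb i) le_sup_right, add_zero]
  zero_mem' := ⟨0, fun i => smul_zero _⟩
  smul_mem' := by
    rintro c m ⟨N, hN⟩
    exact ⟨N, fun i => by rw [← smul_comm c _ m, hN i, smul_zero]⟩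

/-- `M` is a weight module: `M = ⊕_λ M_λ`. -/
def IsWeightModule : Prop :=
  letI := Classical.decEq (Fin n → K)
  DirectSum.IsInternal (fun lam : Fin n → K => weightSpace K n M lam)

/-- `M` is a generalized weight module: `M = ⊕_λ M^λ`. -/
def IsGenWeightModule : Prop :=
  letI := Classical.decEq (Fin n → K)
  DirectSum.IsInternal (fun lam : Fin n → K => genWeightSpace K n M lam)

/-- The support `Supp(M) = {λ | M^λ ≠ 0}`. -/
def supp : Set (Fin n → K) := {lam | genWeightSpace K n M lam ≠ ⊥}

/-- `M` is an indecomposable `𝕀_n`-module. -/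
def IsIndecomposableMod : Prop :=
  Nontrivial M ∧ ∀ p q : Submodule (In K n) M, IsCompl p q → p = ⊥ ∨ q = ⊥

/-- The annihilator of an `𝕀_n`-module, as a set. -/
def annSet : Set (In K n) := {a | ∀ m : M, a • m = 0}

end Modules

/-- A prime (two-sided) ideal of the noncommutative ring `𝕀_n`, given as a set:
`S ≠ 𝕀_n` and `a 𝕀_n b ⊆ S → a ∈ S ∨ b ∈ S`. -/
def IsPrimeSet (S : Set (In K n)) : Prop :=
  S ≠ Set.univ ∧ ∀ a b : In K n, (∀ r : In K n, a * r * b ∈ S) → a ∈ S ∨ b ∈ S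

-- orbits
/-- The `ℤ^n`-orbit of `λ ∈ K^n`. -/
def orbitOf (lam : Fin n → K) : Set (Fin n → K) :=
  {mu | ∀ i, ∃ z : ℤ, mu i - lam i = (z : K)}

/-- The setoid on `K^n` whose classes are the `ℤ^n`-orbits. -/
def orbitSetoid : Setoid (Fin n → K) where
  r mu nu := ∀ i, ∃ z : ℤ, mu i - nu i = (z : K)
  iseqv := by
    constructor
    · intro x i; exact ⟨0, by simp⟩
    · intro x y h i
      obtain ⟨z, hz⟩ := h i
      exact ⟨-z, by push_cast; linear_combination -hz⟩
    · intro x y z hxy hyz i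
      obtain ⟨a, ha⟩ := hxy i
      obtain ⟨b, hb⟩ := hyz i
      exact ⟨a + b, by push_cast; linear_combination ha + hb⟩

/-- `𝔻_Ω = {i | Ω_i = ℤ}` for the orbit `Ω` of `λ`. -/
def DD (lam : Fin n → K) : Set (Fin n) := {i | ∃ z : ℤ, lam i = (z : K)}

/-- `λ` is the normalized representative of its orbit: integer coordinates are `0`. -/
def IsNormalized (lam : Fin n → K) : Prop := ∀ i, (∃ z : ℤ, lam i = (z : K)) → lam i = 0


-- I_1 specifics
/-- The matrix units `e_{st} = ∫^s ∂^t − ∫^{s+1} ∂^{t+1}` of `𝕀_1`. -/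
def eEl1 (s t : ℕ) : In K 1 :=
  intEl K 1 0 ^ s * dEl K 1 0 ^ t - intEl K 1 0 ^ (s + 1) * dEl K 1 0 ^ (t + 1)

/-- `F = ⊕ K e_{st}`, the unique proper two-sided ideal of `𝕀_1`, here as the left ideal
generated by the `e_{st}` (the two coincide). -/
def Fideal : Submodule (In K 1) (In K 1) :=
  Submodule.span (In K 1) {a | ∃ s t : ℕ, a = eEl1 K s t}

/-- The left ideal `F + 𝕀_1 (H − μ)^s`. -/
def MslIdeal (s : ℕ) (mu : K) : Submodule (In K 1) (In K 1) :=
  Fideal K ⊔ Submodule.span (In K 1) {(HEl K 1 0 - algebraMap K (In K 1) mu) ^ s}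

/-- The `𝕀_1`-module `M(s,μ) = 𝕀_1/(F + 𝕀_1 (H − μ)^s)`. -/
def Msl (s : ℕ) (mu : K) := (In K 1) ⧸ MslIdeal K s mu

instance (s : ℕ) (mu : K) : AddCommGroup (Msl K s mu) :=
  inferInstanceAs (AddCommGroup ((In K 1) ⧸ MslIdeal K s mu))
instance (s : ℕ) (mu : K) : Module (In K 1) (Msl K s mu) :=
  inferInstanceAs (Module (In K 1) ((In K 1) ⧸ MslIdeal K s mu))
instance (s : ℕ) (mu : K) : Module K (Msl K s mu) :=
  inferInstanceAs (Module K ((In K 1) ⧸ MslIdeal K s mu))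
instance (s : ℕ) (mu : K) : IsScalarTower K (In K 1) (Msl K s mu) :=
  inferInstanceAs (IsScalarTower K (In K 1) ((In K 1) ⧸ MslIdeal K s mu))

-- two-sided ideals of I_n
/-- The element `e_{st}(i) ∈ 𝕀_n` built from the `i`-th tensor factor. -/
def eElN (i : Fin n) (s t : ℕ) : In K n :=
  intEl K n i ^ s * dEl K n i ^ t - intEl K n i ^ (s + 1) * dEl K n i ^ (t + 1)

/-- The height one prime `𝔭_i`, the two-sided ideal of `𝕀_n` generated by `F(i)`. -/
def pIdeal (i : Fin n) : TwoSidedIdeal (In K n) :=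
  TwoSidedIdeal.span {a | ∃ s t : ℕ, a = eElN K n i s t}

/-- `𝔞_n(I) = Σ_{i ∈ I} 𝔭_i`. -/
def aIdeal (I : Set (Fin n)) : TwoSidedIdeal (In K n) := ⨆ i ∈ I, pIdeal K n i


-- bundled modules
universe u

/-- A bundled `𝕀_n`-module (with compatible `K`-structure). -/
structure ModN (K : Type u) [Field K] [CharZero K] (n : ℕ) : Type (u + 1) where
  carrier : Type u
  [instAdd : AddCommGroup carrier]
  [instK : Module K carrier]
  [instIn : Module (In K n) carrier]
  [instTower : IsScalarTower K (In K n) carrier]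

attribute [instance] ModN.instAdd ModN.instK ModN.instIn ModN.instTower

/-- The endomorphism of `M_1 ⊗ ⋯ ⊗ M_n` acting by `a ∈ 𝕀_1` on the `i`-th factor. -/
def tprodMap (Mi : Fin n → ModN K 1) (i : Fin n) (a : In K 1) :
    (⨂[K] j, (Mi j).carrier) →ₗ[K] ⨂[K] j, (Mi j).carrier :=
  PiTensorProduct.map (Function.update
    (fun j => (LinearMap.id : (Mi j).carrier →ₗ[K] (Mi j).carrier)) i
    (DistribMulAction.toLinearMap K ((Mi i).carrier) a))

/-- The `𝕀_n`-module `M` "is" the tensor product `M_1 ⊗ ⋯ ⊗ M_n` of the `𝕀_1`-modules `M_i`: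
there is a `K`-linear isomorphism under which the generators `x_i, ∂_i, ∫_i` of `𝕀_n` act on
the `i`-th tensor factor via the corresponding generators of `𝕀_1`. -/
def RealizesTensor (Mi : Fin n → ModN K 1) (M : Type*) [AddCommGroup M] [Module K M]
    [Module (In K n) M] [IsScalarTower K (In K n) M] : Prop :=
  ∃ φ : M ≃ₗ[K] ⨂[K] j, (Mi j).carrier,
    ∀ (i : Fin n) (m : M),
      φ (xEl K n i • m) = tprodMap K n Mi i (xEl K 1 0) (φ m) ∧
      φ (dEl K n i • m) = tprodMap K n Mi i (dEl K 1 0) (φ m) ∧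
      φ (intEl K n i • m) = tprodMap K n Mi i (intEl K 1 0) (φ m)

/-- `M` is (isomorphic to) the simple weight module `M(𝒟_Ω)` attached to the orbit of `λ`
and the subset `𝒟 ⊆ 𝔻_Ω`: the tensor product of copies of `K[x]` (for `i ∈ 𝒟`) and of
`M(1, λ_i)` (for `i ∉ 𝒟`). -/
def RealizesMD (lam : Fin n → K) (D : Set (Fin n)) (M : Type*) [AddCommGroup M] [Module K M]
    [Module (In K n) M] [IsScalarTower K (In K n) M] : Prop :=
  ∃ Mi : Fin n → ModN K 1,
    (∀ i, i ∈ D → Nonempty ((Mi i).carrier ≃ₗ[In K 1] P K 1)) ∧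
    (∀ i, i ∉ D → Nonempty ((Mi i).carrier ≃ₗ[In K 1] Msl K 1 (lam i))) ∧
    RealizesTensor K n Mi M

/-- `M` is (isomorphic to) the module `P_{n-1} ⊗ M(s, λ)` (with the copy of `M(s,λ)` placed
in position `j`). -/
def RealizesPMs (lam : Fin n → K) (j : Fin n) (s : ℕ) (M : Type*) [AddCommGroup M] [Module K M]
    [Module (In K n) M] [IsScalarTower K (In K n) M] : Prop :=
  ∃ Mi : Fin n → ModN K 1,
    (∀ i, i ≠ j → Nonempty ((Mi i).carrier ≃ₗ[In K 1] P K 1)) ∧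
    Nonempty ((Mi j).carrier ≃ₗ[In K 1] Msl K s (lam j)) ∧
    RealizesTensor K n Mi M

/-- Membership in the category `GW(𝕀_n, 𝒟_Ω)`: generalized weight modules with support in the
orbit of `λ` all of whose simple subquotients are isomorphic to `M(𝒟_Ω)`. -/
def InGWD (lam : Fin n → K) (D : Set (Fin n)) (M : Type*) [AddCommGroup M] [Module K M]
    [Module (In K n) M] [IsScalarTower K (In K n) M] : Prop :=
  IsGenWeightModule K n M ∧ supp K n M ⊆ orbitOf K n lam ∧
  ∀ (p q : Submodule (In K n) M), p ≤ q →
    IsSimpleModule (In K n) (q ⧸ Submodule.comap q.subtype p) →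
    RealizesMD K n lam D (q ⧸ Submodule.comap q.subtype p)

/-- The support `S(𝒟_Ω) = ℕ_+^{𝒟_Ω} × ∏_{i ∉ 𝒟_Ω} (λ_i + ℤ)` of the module `M(𝒟_Ω)`. -/
def SuppMD (lam : Fin n → K) (D : Set (Fin n)) : Set (Fin n → K) :=
  {mu | (∀ i ∈ D, ∃ m : ℕ, 0 < m ∧ mu i = (m : K)) ∧
        (∀ i ∉ D, ∃ z : ℤ, mu i = lam i + (z : K))}

/-- `M` is an absolutely prime `𝕀_n`-module: its annihilator is a prime ideal and every
nonzero subfactor of `M` has the same annihilator. -/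
def IsAbsolutelyPrime (M : Type*) [AddCommGroup M] [Module K M]
    [Module (In K n) M] [IsScalarTower K (In K n) M] : Prop :=
  IsPrimeSet K n (annSet K n M) ∧
  ∀ (p q : Submodule (In K n) M), p ≤ q →
    Nontrivial (q ⧸ Submodule.comap q.subtype p) →
    annSet K n (q ⧸ Submodule.comap q.subtype p) = annSet K n M


-- the commutative subalgebra D_n = K[H_1, …, H_n]
lemma xEl_smul (i : Fin n) (p : P K n) : xEl K n i • p = MvPolynomial.X i * p := rfl

lemma dEl_smul (i : Fin n) (p : P K n) : dEl K n i • p = MvPolynomial.pderiv i p := rfl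

lemma hEl_monomial (i : Fin n) (α : Fin n →₀ ℕ) (c : K) :
    HEl K n i • (MvPolynomial.monomial α c : P K n)
      = (((α i : ℕ) : K) + 1) • MvPolynomial.monomial α c := by
  have hx : xEl K n i • (MvPolynomial.monomial α c : P K n)
      = MvPolynomial.monomial (α + Finsupp.single i 1) c := by
    rw [xEl_smul, MvPolynomial.X, MvPolynomial.monomial_mul, one_mul, add_comm]
  rw [HEl, mul_smul, hx, dEl_smul, MvPolynomial.pderiv_monomial,
    add_tsub_cancel_right, MvPolynomial.smul_monomial, Finsupp.add_apply,
    Finsupp.single_eq_same, smul_eq_mul]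
  congr 1
  push_cast
  ring

private lemma In_ext {a b : In K n} (h : ∀ p : P K n, a • p = b • p) : a = b := by
  have : (show InSub K n from a) = (show InSub K n from b) :=
    Subtype.ext (LinearMap.ext fun p => h p)
  exact this

lemma hEl_comm (i j : Fin n) : HEl K n i * HEl K n j = HEl K n j * HEl K n i := by
  apply In_ext
  intro p
  induction p using MvPolynomial.induction_on' with
  | monomial α c =>
      have key : ∀ a b : Fin n, (HEl K n a * HEl K n b) • (MvPolynomial.monomial α c : P K n)
          = ((((α b : ℕ) : K) + 1) * (((α a : ℕ) : K) + 1)) • MvPolynomial.monomial α c := by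
        intro a b
        rw [mul_smul, hEl_monomial, ← smul_comm, hEl_monomial, smul_smul]
      rw [key, key, mul_comm]
  | add p q hp hq =>
      rw [smul_add, smul_add, hp, hq]

/-- `D_n = K[H_1, …, H_n]` as a subalgebra of `𝕀_n`. -/
def DnSub : Subalgebra K (In K n) := Algebra.adjoin K (Set.range (HEl K n))

/-- The commutative algebra `D_n` (as a type). -/
def Dn : Type _ := DnSub K n

instance : CommRing (Dn K n) :=
  Algebra.adjoinCommRingOfComm K (by rintro a ⟨i, rfl⟩ b ⟨j, rfl⟩; exact hEl_comm K n i j)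

instance : Algebra K (Dn K n) := inferInstanceAs (Algebra K (DnSub K n))

/-- The inclusion `D_n → 𝕀_n`. -/
def dnVal : Dn K n →+* In K n := ((DnSub K n).val : DnSub K n →ₐ[K] In K n).toRingHom

/-- `H_i` as an element of `D_n`. -/
def HElD (i : Fin n) : Dn K n :=
  show DnSub K n from ⟨HEl K n i, Algebra.subset_adjoin ⟨i, rfl⟩⟩

lemma dn_comm (d : Dn K n) (i : Fin n) :
    dnVal K n d * HEl K n i = HEl K n i * dnVal K n d := by
  have h1 : DnSub K n ≤ Subalgebra.centralizer K (Set.range (HEl K n)) := by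
    apply Algebra.adjoin_le
    rintro x ⟨j, rfl⟩
    rw [SetLike.mem_coe, Subalgebra.mem_centralizer_iff]
    rintro g ⟨i', rfl⟩
    exact hEl_comm K n i' j
  have h2 := (Subalgebra.mem_centralizer_iff K).mp
    (h1 (show DnSub K n from d).2) (HEl K n i) ⟨i, rfl⟩
  exact h2.symm


section DnModules

variable (M : Type*) [AddCommGroup M] [Module K M] [Module (In K n) M]
  [IsScalarTower K (In K n) M]

lemma genWS_stable (lam : Fin n → K) {m : M} (hm : m ∈ genWeightSpace K n M lam)
    (d : Dn K n) : dnVal K n d • m ∈ genWeightSpace K n M lam := by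
  obtain ⟨N, hN⟩ := hm
  refine ⟨N, fun i => ?_⟩
  have hc : Commute (dnVal K n d) ((HEl K n i - algebraMap K (In K n) (lam i)) ^ N) := by
    apply Commute.pow_right
    exact Commute.sub_right (dn_comm K n d i) ((Algebra.commutes (lam i) (dnVal K n d)).symm)
  rw [← mul_smul, ← hc.eq, mul_smul, hN i, smul_zero]

instance genWS_smul (lam : Fin n → K) : SMul (Dn K n) (genWeightSpace K n M lam) :=
  ⟨fun d w => ⟨dnVal K n d • (w : M), genWS_stable K n M lam w.2 d⟩⟩

instance genWS_module (lam : Fin n → K) : Module (Dn K n) (genWeightSpace K n M lam) :=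
  Module.ofMinimalAxioms
    (fun d x y => Subtype.ext (smul_add (dnVal K n d) (x : M) (y : M)))
    (fun d d' x => Subtype.ext (show dnVal K n (d + d') • (x : M)
      = dnVal K n d • (x : M) + dnVal K n d' • (x : M) by rw [map_add, add_smul]))
    (fun d d' x => Subtype.ext (show dnVal K n (d * d') • (x : M)
      = dnVal K n d • (dnVal K n d' • (x : M)) by rw [map_mul, mul_smul]))
    (fun x => Subtype.ext (show dnVal K n 1 • (x : M) = (x : M) by rw [map_one, one_smul]))

instance genWS_tower (lam : Fin n → K) :
    IsScalarTower K (Dn K n) (genWeightSpace K n M lam) :=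
  ⟨fun c d w => Subtype.ext (show dnVal K n (c • d) • (w : M) = c • (dnVal K n d • (w : M)) by
    rw [show dnVal K n (c • d) = c • dnVal K n d from map_smul (DnSub K n).val c d, smul_assoc])⟩

end DnModules

/-- The maximal ideal `𝔪_λ = (H_1 − λ_1, …, H_n − λ_n)` of `D_n`. -/
def mIdeal (lam : Fin n → K) : Ideal (Dn K n) :=
  Ideal.span {d | ∃ i, d = HElD K n i - algebraMap K (Dn K n) (lam i)}

/-- The category `LF_𝔪(D_n)` of `𝔪_λ`-locally finite `D_n`-modules: every cyclic submodule is
finite dimensional over `K` and annihilated by a power of `𝔪_λ`. -/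
def IsLF (lam : Fin n → K) (N : Type*) [AddCommGroup N] [Module K N] [Module (Dn K n) N]
    [IsScalarTower K (Dn K n) N] : Prop :=
  ∀ x : N, FiniteDimensional K ((Submodule.span (Dn K n) {x}).restrictScalars K) ∧
    ∃ s : ℕ, ∀ i, ((HElD K n i - algebraMap K (Dn K n) (lam i)) ^ s) • x = 0

-- the algebra B_n = 𝕀_n/𝔞_n
/-- The maximal ideal `𝔞_n = 𝔭_1 + ⋯ + 𝔭_n` of `𝕀_n`. -/
def aFull : TwoSidedIdeal (In K n) := aIdeal K n Set.univ

/-- The skew Laurent polynomial algebra `B_n = 𝕀_n/𝔞_n`. -/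
def Bn : Type _ := (aFull K n).ringCon.Quotient

instance : Ring (Bn K n) := inferInstanceAs (Ring (aFull K n).ringCon.Quotient)

/-- The quotient map `𝕀_n → B_n`. -/
def toBn : In K n →+* Bn K n := RingCon.mk' _

lemma toBn_surjective : Function.Surjective (toBn K n) :=
  Quotient.mk''_surjective

/-- The composite `D_n → 𝕀_n → B_n`. -/
def bnD : Dn K n →+* Bn K n := (toBn K n).comp (dnVal K n)

/-- `B_n` as a right `D_n`-module (written as a left module structure, `d • b = b ⬝ d`). -/
instance : SMul (Dn K n) (Bn K n) := ⟨fun d b => b * bnD K n d⟩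

instance : Module (Dn K n) (Bn K n) :=
  Module.ofMinimalAxioms
    (fun d x y => show (x + y) * bnD K n d = x * bnD K n d + y * bnD K n d from add_mul _ _ _)
    (fun d d' x => show x * bnD K n (d + d') = x * bnD K n d + x * bnD K n d' by
      rw [map_add, mul_add])
    (fun d d' x => show x * bnD K n (d * d') = (x * bnD K n d') * bnD K n d by
      rw [mul_comm d d', map_mul, ← mul_assoc])
    (fun x => show x * bnD K n 1 = x by rw [map_one, mul_one])

instance : SMulCommClass (Dn K n) (Bn K n) (Bn K n) :=
  ⟨fun d b m => show (b * m) * bnD K n d = b * (m * bnD K n d) from mul_assoc b m (bnD K n d)⟩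

/-- The induced module `B_n ⊗_{D_n} N` of a `D_n`-module `N`. -/
def Ind (N : Type*) [AddCommGroup N] [Module (Dn K n) N] : Type _ :=
  (Bn K n) ⊗[Dn K n] N

section Ind

variable (N : Type*) [AddCommGroup N] [Module (Dn K n) N]

instance : AddCommGroup (Ind K n N) :=
  inferInstanceAs (AddCommGroup ((Bn K n) ⊗[Dn K n] N))

instance indModuleBn : Module (Bn K n) (Ind K n N) :=
  inferInstanceAs (Module (Bn K n) ((Bn K n) ⊗[Dn K n] N))

instance indModuleDn : Module (Dn K n) (Ind K n N) :=
  inferInstanceAs (Module (Dn K n) ((Bn K n) ⊗[Dn K n] N))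

instance indModuleIn : Module (In K n) (Ind K n N) := Module.compHom _ (toBn K n)

instance indModuleK : Module K (Ind K n N) := Module.compHom _ (algebraMap K (Dn K n))

lemma bn_algebraMap_comm (c : K) (u : Bn K n) :
    toBn K n (algebraMap K (In K n) c) * u = u * toBn K n (algebraMap K (In K n) c) := by
  obtain ⟨r, rfl⟩ := toBn_surjective K n u
  rw [← map_mul, ← map_mul, Algebra.commutes]

lemma dnVal_algebraMap (c : K) :
    dnVal K n (algebraMap K (Dn K n) c) = algebraMap K (In K n) c :=
  AlgHom.commutes (DnSub K n).val c

lemma ind_key (c : K) (w : (Bn K n) ⊗[Dn K n] N) :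
    (toBn K n (algebraMap K (In K n) c)) • w = (algebraMap K (Dn K n) c) • w := by
  induction w using TensorProduct.induction_on with
  | zero => rw [smul_zero, smul_zero]
  | tmul b x =>
      rw [TensorProduct.smul_tmul', TensorProduct.smul_tmul']
      congr 1
      show toBn K n (algebraMap K (In K n) c) * b = b * bnD K n (algebraMap K (Dn K n) c)
      have h1 : bnD K n (algebraMap K (Dn K n) c) = toBn K n (algebraMap K (In K n) c) := by
        show toBn K n (dnVal K n (algebraMap K (Dn K n) c)) = _
        rw [dnVal_algebraMap]
      rw [h1, bn_algebraMap_comm]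
  | add x y hx hy => rw [smul_add, smul_add, hx, hy]

instance indTower : IsScalarTower K (In K n) (Ind K n N) := by
  constructor
  intro c a v
  show toBn K n (c • a) • v = algebraMap K (Dn K n) c • ((toBn K n a : Bn K n) • v)
  rw [Algebra.smul_def, map_mul, mul_smul]
  exact ind_key K n N c (toBn K n a • v)

end Ind


section BnQuot

variable (J : Submodule (Bn K n) (Bn K n))

instance : Module (In K n) (Bn K n ⧸ J) := Module.compHom _ (toBn K n)

instance : Module K (Bn K n ⧸ J) :=
  Module.compHom _ ((toBn K n).comp (algebraMap K (In K n)))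

instance : IsScalarTower K (In K n) (Bn K n ⧸ J) := by
  constructor
  intro c a v
  show toBn K n (c • a) • v = (toBn K n (algebraMap K (In K n) c)) • (toBn K n a • v)
  rw [Algebra.smul_def, map_mul, mul_smul]

end BnQuot

/-- The `𝕀_n`-module `M` "is" the tensor product `A ⊗ B` of an `𝕀_m`-module `A` and an
`𝕀_{n-m}`-module `B`: there is a `K`-linear isomorphism under which the generators of `𝕀_n`
with index `< m` act on the first factor (via the corresponding generators of `𝕀_m`) and the
remaining generators act on the second factor (via the generators of `𝕀_{n-m}`). -/
def RealizesSplit (m : ℕ) (A : Type*) [AddCommGroup A] [Module K A] [Module (In K m) A]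
    [IsScalarTower K (In K m) A]
    (B : Type*) [AddCommGroup B] [Module K B] [Module (In K (n - m)) B]
    [IsScalarTower K (In K (n - m)) B]
    (M : Type*) [AddCommGroup M] [Module K M] [Module (In K n) M]
    [IsScalarTower K (In K n) M] : Prop :=
  ∃ φ : M ≃ₗ[K] A ⊗[K] B,
    (∀ (i : Fin n) (hi : (i : ℕ) < m) (v : M),
      φ (xEl K n i • v) = LinearMap.rTensor B
        (DistribMulAction.toLinearMap K A (xEl K m ⟨i, hi⟩)) (φ v) ∧
      φ (dEl K n i • v) = LinearMap.rTensor B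
        (DistribMulAction.toLinearMap K A (dEl K m ⟨i, hi⟩)) (φ v) ∧
      φ (intEl K n i • v) = LinearMap.rTensor B
        (DistribMulAction.toLinearMap K A (intEl K m ⟨i, hi⟩)) (φ v)) ∧
    (∀ (i : Fin n) (hi : m ≤ (i : ℕ)) (v : M),
      φ (xEl K n i • v) = LinearMap.lTensor A
        (DistribMulAction.toLinearMap K B (xEl K (n - m) ⟨(i : ℕ) - m, by omega⟩)) (φ v) ∧
      φ (dEl K n i • v) = LinearMap.lTensor A
        (DistribMulAction.toLinearMap K B (dEl K (n - m) ⟨(i : ℕ) - m, by omega⟩)) (φ v) ∧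
      φ (intEl K n i • v) = LinearMap.lTensor A
        (DistribMulAction.toLinearMap K B (intEl K (n - m) ⟨(i : ℕ) - m, by omega⟩)) (φ v))

end


section Proof2

variable (K : Type*) [Field K] [CharZero K]

private noncomputable def yy (m : ℕ) : P K 1 := MvPolynomial.monomial (Finsupp.single 0 m) ((m.factorial : K)⁻¹)

private lemma yy_ind {p : P K 1 → Prop} (hadd : ∀ f g, p f → p g → p (f + g))
    (hs : ∀ (c : K) f, p f → p (c • f)) (hy : ∀ m, p (yy K m)) (f : P K 1) : p f := by
  induction f using MvPolynomial.induction_on' with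
  | monomial α c =>
      have h : (MvPolynomial.monomial α c : P K 1)
          = (c * ((α 0).factorial : K)) • yy K (α 0) := by
        have hf : ((α 0).factorial : K) ≠ 0 := by exact_mod_cast (α 0).factorial_ne_zero
        have h2 : Finsupp.single 0 (α 0) = α := by
          refine Finsupp.ext fun i => ?_
          fin_cases i; simp
        rw [yy, MvPolynomial.smul_monomial, h2, smul_eq_mul, mul_assoc, mul_inv_cancel₀ hf, mul_one]
      rw [h]; exact hs _ _ (hy _)
  | add f g hf hg => exact hadd _ _ hf hg

private lemma int_yy (m : ℕ) : intEl K 1 0 • yy K m = yy K (m + 1) := by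
  show intOp K 1 0 (yy K m) = _
  have : yy K m = ((m.factorial : K)⁻¹) • (MvPolynomial.basisMonomials (Fin 1) K (Finsupp.single 0 m)) := by
    simp [yy, MvPolynomial.smul_monomial]
  rw [this, map_smul, intOp, Module.Basis.constr_basis, smul_smul, MvPolynomial.smul_monomial, yy,
    ← Finsupp.single_add]
  congr 1
  have h1 : ((m : K) + 1) ≠ 0 := by exact_mod_cast m.succ_ne_zero
  simp [Nat.factorial_succ, mul_comm]

private lemma d_yy (m : ℕ) : dEl K 1 0 • yy K (m + 1) = yy K m := by
  rw [dEl_smul, yy, MvPolynomial.pderiv_monomial, yy]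
  have h1 : ((m : K) + 1) ≠ 0 := by exact_mod_cast m.succ_ne_zero
  have hf : ((m).factorial : K) ≠ 0 := by exact_mod_cast (m).factorial_ne_zero
  congr 1
  · simp
  · simp [Nat.factorial_succ]; field_simp

private lemma d_yy0 : dEl K 1 0 • yy K 0 = 0 := by
  rw [dEl_smul, yy, MvPolynomial.pderiv_monomial]; simp

private lemma H_yy (m : ℕ) : HEl K 1 0 • yy K m = ((m : K) + 1) • yy K m := by
  rw [yy, hEl_monomial]; simp

private lemma y_ext {a b : In K 1} (h : ∀ m, a • yy K m = b • yy K m) : a = b := by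
  apply In_ext
  intro p
  induction p using yy_ind K with
  | hadd f g hf hg => rw [smul_add, smul_add, hf, hg]
  | hs c f hf => rw [← smul_comm c, ← smul_comm c, hf]
  | hy m => exact h m

private lemma x_eq : xEl K 1 0 = intEl K 1 0 * HEl K 1 0 := by
  apply y_ext; intro m
  rw [mul_smul, H_yy, ← smul_comm, int_yy, xEl_smul, yy, yy, MvPolynomial.X, MvPolynomial.monomial_mul,
    MvPolynomial.smul_monomial, ← Finsupp.single_add, add_comm 1 m]
  have h1 : ((m : K) + 1) ≠ 0 := by exact_mod_cast m.succ_ne_zero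
  have hf : ((m).factorial : K) ≠ 0 := by exact_mod_cast (m).factorial_ne_zero
  congr 1
  simp [Nat.factorial_succ]; field_simp

private lemma d_int : dEl K 1 0 * intEl K 1 0 = 1 := by
  apply y_ext; intro m
  rw [mul_smul, int_yy, d_yy, one_smul]

private lemma H_int : HEl K 1 0 * intEl K 1 0 = intEl K 1 0 * (HEl K 1 0 + 1) := by
  apply y_ext; intro m
  rw [mul_smul, mul_smul, add_smul, H_yy, int_yy, H_yy, one_smul, smul_add, ← smul_comm, int_yy,
    add_smul _ (1:K), one_smul]
  push_cast; rfl

private lemma H_d : HEl K 1 0 * dEl K 1 0 = dEl K 1 0 * (HEl K 1 0 - 1) := by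
  apply y_ext; intro m
  rw [mul_smul, mul_smul, sub_smul, H_yy, one_smul, smul_sub, ← smul_comm ((m : K) + 1) (dEl K 1 0)]
  cases m with
  | zero => simp [d_yy0]
  | succ m =>
    rw [d_yy, H_yy]; push_cast; module

private lemma e_yy (s t m : ℕ) (h : t < m) : eEl1 K s t • yy K m = 0 := by
  have hd : ∀ t m, dEl K 1 0 ^ t • yy K (m + t) = yy K m := by
    intro t; induction t with
    | zero => intro m; simp
    | succ t ih => intro m; rw [pow_succ, mul_smul, ← add_assoc, d_yy, ih]
  have hi : ∀ t m, intEl K 1 0 ^ t • yy K m = yy K (m + t) := by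
    intro t; induction t with
    | zero => intro m; simp
    | succ t ih => intro m; rw [pow_succ, mul_smul, int_yy, ih]; congr 1; ring
  obtain ⟨k, rfl⟩ := Nat.exists_eq_add_of_lt h
  rw [eEl1, sub_smul, mul_smul, mul_smul, show t + k + 1 = (k + 1) + t by ring, hd,
    show (k + 1) + t = k + (t + 1) by ring, hd, hi, hi, sub_eq_zero]
  congr 1; ring

private lemma e0_H (t : ℕ) : eEl1 K 0 t * HEl K 1 0 = ((t : K) + 1) • eEl1 K 0 t := by
  have hd : ∀ t : ℕ, dEl K 1 0 ^ t * HEl K 1 0 = HEl K 1 0 * dEl K 1 0 ^ t + (t : K) • dEl K 1 0 ^ t := by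
    intro t; induction t with
    | zero => simp
    | succ t ih =>
      have h1 : dEl K 1 0 * HEl K 1 0 = HEl K 1 0 * dEl K 1 0 + dEl K 1 0 := by
        rw [H_d]; noncomm_ring
      rw [pow_succ, mul_assoc, h1, mul_add, ← mul_assoc, ih, add_mul, smul_mul_assoc, mul_assoc]
      push_cast
      rw [add_smul, one_smul, add_assoc]
  have h2 : (1 - intEl K 1 0 * dEl K 1 0) * HEl K 1 0 = 1 - intEl K 1 0 * dEl K 1 0 := by
    apply y_ext; intro m
    rw [mul_smul, H_yy, ← smul_comm, sub_smul, mul_smul, one_smul]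
    cases m with
    | zero => simp [d_yy0]
    | succ m => simp [d_yy, int_yy]
  have h3 : eEl1 K 0 t = (1 - intEl K 1 0 * dEl K 1 0) * dEl K 1 0 ^ t := by
    rw [eEl1, pow_succ' (dEl K 1 0)]; noncomm_ring
  rw [h3, mul_assoc, hd, mul_add, ← mul_assoc, h2, mul_smul_comm, add_smul, one_smul, add_comm]

private lemma In_ind {p : In K 1 → Prop} (hx : p (xEl K 1 0)) (hd : p (dEl K 1 0))
    (hi : p (intEl K 1 0)) (ha : ∀ c, p (algebraMap K (In K 1) c))
    (hadd : ∀ a b, p a → p b → p (a + b)) (hmul : ∀ a b, p a → p b → p (a * b)) (a : In K 1) : p a := by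
  obtain ⟨a, h⟩ := a
  exact Algebra.adjoin_induction (p := fun a h => p (⟨a, h⟩ : InSub K 1))
    (by
      rintro x ((⟨i, rfl⟩ | ⟨i, rfl⟩) | ⟨i, rfl⟩)
      · obtain rfl := Subsingleton.elim i 0; exact hx
      · obtain rfl := Subsingleton.elim i 0; exact hd
      · obtain rfl := Subsingleton.elim i 0; exact hi)
    (fun r => ha r) (fun x y _ _ h1 h2 => hadd _ _ h1 h2) (fun x y _ _ h1 h2 => hmul _ _ h1 h2) h


private noncomputable def LL (k : ℕ) : P K 1 →ₗ[K] K :=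
  (k.factorial : K) • MvPolynomial.lcoeff K (Finsupp.single 0 k)

private lemma LL_yy (k m : ℕ) : LL K k (yy K m) = if k = m then 1 else 0 := by
  have hf : ((k).factorial : K) ≠ 0 := by exact_mod_cast (k).factorial_ne_zero
  simp only [LL, yy, LinearMap.smul_apply, MvPolynomial.lcoeff_apply, MvPolynomial.coeff_monomial,
    smul_eq_mul]
  by_cases h : k = m
  · subst h; simp [hf]
  · have : ¬ (Finsupp.single (0 : Fin 1) m = Finsupp.single 0 k) := by
      intro h2; exact h (Finsupp.single_injective _ h2).symm
    simp [h, this]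

private lemma LL_d (k : ℕ) (f : P K 1) : LL K k (dEl K 1 0 • f) = LL K (k + 1) f := by
  induction f using yy_ind K with
  | hadd f g hf hg => rw [smul_add, map_add, map_add, hf, hg]
  | hs c f hf => rw [← smul_comm c, (LL K _).map_smul c, (LL K _).map_smul c, hf]
  | hy m =>
    cases m with
    | zero => simp [d_yy0, LL_yy]
    | succ m => simp [d_yy, LL_yy]

private lemma LL_int (k : ℕ) (f : P K 1) : LL K (k + 1) (intEl K 1 0 • f) = LL K k f := by
  induction f using yy_ind K with
  | hadd f g hf hg => rw [smul_add, map_add, map_add, hf, hg]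
  | hs c f hf => rw [← smul_comm c, (LL K _).map_smul c, (LL K _).map_smul c, hf]
  | hy m => simp [int_yy, LL_yy]

private lemma LL_H (k : ℕ) (f : P K 1) : LL K k (HEl K 1 0 • f) = ((k : K) + 1) * LL K k f := by
  induction f using yy_ind K with
  | hadd f g hf hg => rw [smul_add, map_add, map_add, hf, hg]; ring
  | hs c f hf => rw [← smul_comm c, (LL K _).map_smul c, (LL K _).map_smul c, hf, smul_eq_mul, smul_eq_mul]; ring
  | hy m =>
    rw [H_yy, map_smul, LL_yy]
    split_ifs with h
    · subst h; simp
    · simp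

private def Good (mu : K) (a : In K 1) : Prop :=
  ∀ z : ℤ, ∃ p : Polynomial K, ∀ᶠ m : ℕ in Filter.atTop,
    LL K ((m : ℤ) + z).toNat (a • yy K m) = p.eval ((m : K) + 1 - mu)

private lemma good_int (mu : K) (a : In K 1) (h : Good K mu a) : Good K mu (intEl K 1 0 * a) := by
  intro z
  obtain ⟨p, hp⟩ := h (z - 1)
  refine ⟨p, ?_⟩
  filter_upwards [hp, Filter.eventually_ge_atTop (z.natAbs + 1)] with m hm h1
  rw [← hm, mul_smul, show ((m : ℤ) + z).toNat = ((m : ℤ) + (z - 1)).toNat + 1 by omega, LL_int]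

private lemma good_d (mu : K) (a : In K 1) (h : Good K mu a) : Good K mu (dEl K 1 0 * a) := by
  intro z
  obtain ⟨p, hp⟩ := h (z + 1)
  refine ⟨p, ?_⟩
  filter_upwards [hp, Filter.eventually_ge_atTop (z.natAbs + 1)] with m hm h1
  rw [← hm, mul_smul, show ((m : ℤ) + (z + 1)).toNat = ((m : ℤ) + z).toNat + 1 by omega, LL_d]

private lemma good_H (mu : K) (a : In K 1) (h : Good K mu a) : Good K mu (HEl K 1 0 * a) := by
  intro z
  obtain ⟨p, hp⟩ := h z
  refine ⟨(Polynomial.X + Polynomial.C (mu + z)) * p, ?_⟩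
  filter_upwards [hp, Filter.eventually_ge_atTop (z.natAbs + 1)] with m hm h1
  have h2 : (((((m : ℤ) + z).toNat : ℕ)) : K) = (m : K) + z := by
    have h3 : ((((m : ℤ) + z).toNat : ℕ) : ℤ) = (m : ℤ) + z := by omega
    have h4 := congrArg (Int.cast : ℤ → K) h3
    push_cast at h4
    exact h4
  rw [mul_smul, LL_H, hm, h2]
  simp only [Polynomial.eval_mul, Polynomial.eval_add, Polynomial.eval_X, Polynomial.eval_C]
  ring

private lemma good_all (mu : K) (a : In K 1) : Good K mu a := by
  have key : ∀ b, Good K mu b → Good K mu (a * b) := by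
    induction a using In_ind K with
    | hx =>
      intro b hb
      rw [x_eq, mul_assoc]
      exact good_int K mu _ (good_H K mu _ hb)
    | hd => exact good_d K mu
    | hi => exact good_int K mu
    | ha c =>
      intro b hb z
      obtain ⟨p, hp⟩ := hb z
      refine ⟨Polynomial.C c * p, ?_⟩
      filter_upwards [hp] with m hm
      rw [← Algebra.smul_def, smul_assoc, map_smul, hm]
      simp
    | hadd a a' h h' =>
      intro b hb z
      obtain ⟨p, hp⟩ := h b hb z
      obtain ⟨q, hq⟩ := h' b hb z
      refine ⟨p + q, ?_⟩
      filter_upwards [hp, hq] with m hm hm'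
      rw [add_mul, add_smul, map_add, hm, hm']
      simp
    | hmul a a' h h' =>
      intro b hb
      rw [mul_assoc]
      exact h _ (h' _ hb)
  have h1 : Good K mu (1 : In K 1) := by
    intro z
    refine ⟨Polynomial.C (if z = 0 then 1 else 0), ?_⟩
    filter_upwards [Filter.eventually_ge_atTop (z.natAbs + 1)] with m hm
    rw [one_smul, LL_yy, Polynomial.eval_C]
    congr 1
    rw [eq_iff_iff]; omega
  simpa using key 1 h1

private lemma Hpow_yy (mu : K) (k m : ℕ) :
    ((HEl K 1 0 - algebraMap K (In K 1) mu) ^ k) • yy K m = ((m : K) + 1 - mu) ^ k • yy K m := by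
  induction k with
  | zero => simp
  | succ k ih =>
    rw [pow_succ, mul_smul, sub_smul, H_yy, algebraMap_smul, ← sub_smul, ← smul_comm, ih, smul_smul,
      pow_succ']

private lemma F_van (a : In K 1) (h : a ∈ Fideal K) :
    ∀ᶠ m : ℕ in Filter.atTop, a • yy K m = 0 := by
  induction h using Submodule.span_induction with
  | mem x hx =>
    obtain ⟨s, t, rfl⟩ := hx
    filter_upwards [Filter.eventually_gt_atTop t] with m hm
    exact e_yy K s t m hm
  | zero => simp
  | add x y _ _ hx hy =>
    filter_upwards [hx, hy] with m h1 h2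
    rw [add_smul, h1, h2, add_zero]
  | smul c x _ hx =>
    filter_upwards [hx] with m h1
    rw [smul_eq_mul, mul_smul, h1, smul_zero]

private lemma J_good (mu : K) (s : ℕ) (a : In K 1) (h : a ∈ MslIdeal K s mu) (z : ℤ) :
    ∃ p : Polynomial K, ∀ᶠ m : ℕ in Filter.atTop,
    LL K ((m : ℤ) + z).toNat (a • yy K m) = (Polynomial.X ^ s * p).eval ((m : K) + 1 - mu) := by
  obtain ⟨f, hf, g, hg, rfl⟩ := Submodule.mem_sup.1 h
  obtain ⟨b, rfl⟩ := Submodule.mem_span_singleton.1 hg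
  obtain ⟨p, hp⟩ := good_all K mu b z
  refine ⟨p, ?_⟩
  filter_upwards [hp, F_van K f hf] with m h1 h2
  rw [add_smul, h2, zero_add, smul_eq_mul, mul_smul, Hpow_yy, ← smul_comm, map_smul, h1]
  simp

private noncomputable def uu : ℤ → In K 1
  | Int.ofNat n => intEl K 1 0 ^ n
  | Int.negSucc n => dEl K 1 0 ^ (n + 1)

private lemma LL_uu (z : ℤ) : ∀ᶠ m : ℕ in Filter.atTop,
    LL K ((m : ℤ) + z).toNat (uu K z • yy K m) = 1 := by
  filter_upwards [Filter.eventually_ge_atTop (z.natAbs + 1)] with m hm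
  have hd : ∀ t m, dEl K 1 0 ^ t • yy K (m + t) = yy K m := by
    intro t; induction t with
    | zero => intro m; simp
    | succ t ih => intro m; rw [pow_succ, mul_smul, ← add_assoc, d_yy, ih]
  have hi : ∀ t m, intEl K 1 0 ^ t • yy K m = yy K (m + t) := by
    intro t; induction t with
    | zero => intro m; simp
    | succ t ih => intro m; rw [pow_succ, mul_smul, int_yy, ih]; congr 1; ring
  match z, hm with
  | Int.ofNat n, hm =>
    rw [uu, hi, LL_yy, if_pos (by simp; omega)]
  | Int.negSucc n, hm =>
    obtain ⟨k, rfl⟩ : ∃ k, m = k + (n + 1) := ⟨m - (n + 1), by simp at hm; omega⟩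
    rw [uu, hd, LL_yy, if_pos (by omega)]

private lemma H_uu (mu : K) (z : ℤ) : (HEl K 1 0 - algebraMap K (In K 1) (mu + z)) * uu K z
    = uu K z * (HEl K 1 0 - algebraMap K (In K 1) mu) := by
  have hi : ∀ n : ℕ, HEl K 1 0 * intEl K 1 0 ^ n = intEl K 1 0 ^ n * (HEl K 1 0 + (n : In K 1)) := by
    intro n; induction n with
    | zero => simp
    | succ n ih =>
      rw [pow_succ, ← mul_assoc, ih, mul_assoc, add_mul, H_int, (Nat.cast_commute n _).eq, ← mul_add,
        mul_assoc]
      push_cast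
      congr 2
      abel
  have hd : ∀ n : ℕ, HEl K 1 0 * dEl K 1 0 ^ n = dEl K 1 0 ^ n * (HEl K 1 0 - (n : In K 1)) := by
    intro n; induction n with
    | zero => simp
    | succ n ih =>
      rw [pow_succ, ← mul_assoc, ih, mul_assoc, sub_mul, H_d, (Nat.cast_commute n _).eq, ← mul_sub,
        mul_assoc]
      push_cast
      congr 2
      abel
  have h : HEl K 1 0 * uu K z = uu K z * (HEl K 1 0 + (z : In K 1)) := by
    match z with
    | Int.ofNat n => simp [uu, hi]
    | Int.negSucc n =>
      rw [uu, hd]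
      simp [sub_eq_add_neg]
  rw [sub_mul, h, map_add, add_mul, Algebra.commutes, map_intCast, (Int.cast_commute z _).eq]
  noncomm_ring

private lemma e0_mem (mu : K) (t k : ℕ) :
    eEl1 K 0 t * (HEl K 1 0 - algebraMap K (In K 1) mu) ^ k ∈ Fideal K := by
  induction k with
  | zero =>
    rw [pow_zero, mul_one]
    exact Submodule.subset_span ⟨0, t, rfl⟩
  | succ k ih =>
    rw [pow_succ', ← mul_assoc, mul_sub, e0_H, ← Algebra.commutes, ← Algebra.smul_def, ← sub_smul,
      smul_mul_assoc, Algebra.smul_def]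
    exact Submodule.smul_mem _ _ ih

private noncomputable def ww (mu : K) (s : ℕ) (z : ℤ) (k : ℕ) : Msl K s mu :=
  (MslIdeal K s mu).mkQ (uu K z * (HEl K 1 0 - algebraMap K (In K 1) mu) ^ k)

private lemma ww_zero (mu : K) (s : ℕ) (z : ℤ) (k : ℕ) (h : s ≤ k) : ww K mu s z k = 0 := by
  apply (Submodule.Quotient.mk_eq_zero _).2
  obtain ⟨j, rfl⟩ := Nat.exists_eq_add_of_le h
  rw [add_comm, pow_add, ← mul_assoc]
  exact Submodule.mem_sup_right (Submodule.smul_mem _ _ (Submodule.mem_span_singleton_self _))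

private lemma H_ww (mu : K) (s : ℕ) (z : ℤ) (k : ℕ) :
    (HEl K 1 0 - algebraMap K (In K 1) (mu + z)) • ww K mu s z k = ww K mu s z (k + 1) := by
  refine Eq.trans ((MslIdeal K s mu).mkQ.map_smul _ _).symm ?_
  rw [ww, smul_eq_mul, ← mul_assoc, H_uu, mul_assoc, ← pow_succ']

private lemma H_ww' (mu : K) (s : ℕ) (z : ℤ) (k : ℕ) :
    HEl K 1 0 • ww K mu s z k = ww K mu s z (k + 1) + (mu + z) • ww K mu s z k := by
  rw [← H_ww, sub_smul, algebraMap_smul, sub_add_cancel]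

private lemma Hpow_ww (mu : K) (s : ℕ) (z : ℤ) (k N : ℕ) :
    ((HEl K 1 0 - algebraMap K (In K 1) (mu + z)) ^ N) • ww K mu s z k = ww K mu s z (k + N) := by
  induction N with
  | zero => simp
  | succ N ih => rw [pow_succ', mul_smul, ih, H_ww]; rfl

private lemma int_ww (mu : K) (s : ℕ) (z : ℤ) (k : ℕ) :
    intEl K 1 0 • ww K mu s z k = ww K mu s (z + 1) k := by
  refine Eq.trans ((MslIdeal K s mu).mkQ.map_smul _ _).symm ?_
  rw [ww, smul_eq_mul]
  match z with
  | Int.ofNat n =>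
    rw [show Int.ofNat n + 1 = Int.ofNat (n + 1) from rfl, uu, uu, ← mul_assoc, pow_succ']
  | Int.negSucc n =>
    have h : uu K (Int.negSucc n + 1) = dEl K 1 0 ^ n := by
      cases n with
      | zero => simp [uu]
      | succ n => rw [show Int.negSucc (n + 1) + 1 = Int.negSucc n by omega, uu]
    rw [h, uu]
    apply (Submodule.Quotient.eq _).2
    have h2 := Submodule.neg_mem _ (e0_mem K mu n k)
    refine Submodule.mem_sup_left ?_
    convert h2 using 1
    rw [eEl1]
    noncomm_ring

private lemma d_ww (mu : K) (s : ℕ) (z : ℤ) (k : ℕ) :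
    dEl K 1 0 • ww K mu s z k = ww K mu s (z - 1) k := by
  have h : dEl K 1 0 * uu K z = uu K (z - 1) := by
    match z with
    | Int.ofNat 0 => rw [show Int.ofNat 0 - 1 = Int.negSucc 0 from rfl, uu, uu, pow_zero, mul_one, zero_add, pow_one]
    | Int.ofNat (n + 1) =>
      rw [show Int.ofNat (n + 1) - 1 = Int.ofNat n by simp, uu, uu, pow_succ', ← mul_assoc, d_int,
        one_mul]
    | Int.negSucc n =>
      rw [show Int.negSucc n - 1 = Int.negSucc (n + 1) by omega, uu, uu, ← pow_succ']
  refine Eq.trans ((MslIdeal K s mu).mkQ.map_smul _ _).symm ?_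
  rw [ww, smul_eq_mul, ← mul_assoc, h]

private noncomputable def Mz (mu : K) (s : ℕ) (z : ℤ) : Submodule K (Msl K s mu) :=
  Submodule.span K (Set.range fun k : Fin s => ww K mu s z k)

private lemma ww_mem (mu : K) (s : ℕ) (z : ℤ) (k : ℕ) : ww K mu s z k ∈ Mz K mu s z := by
  by_cases h : k < s
  · exact Submodule.subset_span ⟨⟨k, h⟩, rfl⟩
  · rw [ww_zero _ _ _ _ _ (not_lt.1 h)]; exact zero_mem _

private lemma Mz_le (mu : K) (s : ℕ) (z : ℤ) :
    Mz K mu s z ≤ genWeightSpace K 1 (Msl K s mu) (fun _ => mu + (z : K)) := by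
  rw [Mz, Submodule.span_le]
  rintro _ ⟨k, rfl⟩
  refine ⟨s, fun i => ?_⟩
  obtain rfl := Subsingleton.elim i 0
  dsimp only
  rw [Hpow_ww]
  exact ww_zero _ _ _ _ _ (by omega)

private lemma Mz_top (mu : K) (s : ℕ) : ⨆ z, Mz K mu s z = ⊤ := by
  rw [eq_top_iff]
  rintro m -
  have hsp : ∀ a : In K 1, ∀ t ∈ ⨆ z, Mz K mu s z, a • t ∈ ⨆ z, Mz K mu s z := by
    have gen : ∀ a : In K 1, (∀ z k, a • ww K mu s z k ∈ ⨆ z, Mz K mu s z) →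
        ∀ t ∈ ⨆ z, Mz K mu s z, a • t ∈ ⨆ z, Mz K mu s z := by
      intro a ha t ht
      induction ht using Submodule.iSup_induction' with
      | mem z x hx =>
        induction hx using Submodule.span_induction with
        | mem x hx => obtain ⟨k, rfl⟩ := hx; exact ha z k
        | zero => rw [smul_zero]; exact zero_mem _
        | add x y _ _ h1 h2 => rw [smul_add]; exact add_mem h1 h2
        | smul c x _ h => rw [← smul_comm c]; exact Submodule.smul_mem _ _ h
      | zero => rw [smul_zero]; exact zero_mem _
      | add x y _ _ h1 h2 => rw [smul_add]; exact add_mem h1 h2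
    have wm : ∀ z k, ww K mu s z k ∈ ⨆ z, Mz K mu s z := fun z k =>
      Submodule.mem_iSup_of_mem z (ww_mem K mu s z k)
    intro a
    induction a using In_ind K with
    | hx =>
      apply gen; intro z k
      rw [x_eq, mul_smul, H_ww', smul_add, ← smul_comm (mu + (z : K)), int_ww, int_ww]
      exact add_mem (wm _ _) (Submodule.smul_mem _ _ (wm _ _))
    | hd => apply gen; intro z k; rw [d_ww]; exact wm _ _
    | hi => apply gen; intro z k; rw [int_ww]; exact wm _ _
    | ha c => intro t ht; rw [algebraMap_smul]; exact Submodule.smul_mem _ _ ht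
    | hadd a b h1 h2 => intro t ht; rw [add_smul]; exact add_mem (h1 t ht) (h2 t ht)
    | hmul a b h1 h2 => intro t ht; rw [mul_smul]; exact h1 _ (h2 t ht)
  obtain ⟨a, rfl⟩ := (MslIdeal K s mu).mkQ_surjective m
  have h := hsp a (ww K mu s 0 0) (Submodule.mem_iSup_of_mem 0 (ww_mem K mu s 0 0))
  have h2 : a • ww K mu s 0 0 = (MslIdeal K s mu).mkQ a := by
    refine Eq.trans ((MslIdeal K s mu).mkQ.map_smul _ _).symm ?_
    rw [show (0 : ℤ) = Int.ofNat 0 from rfl, uu, pow_zero, pow_zero, mul_one, smul_eq_mul, mul_one]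
  rw [h2] at h
  exact h

private lemma ww_li (mu : K) (s : ℕ) (z : ℤ) :
    LinearIndependent K (fun k : Fin s => ww K mu s z k) := by
  rw [Fintype.linearIndependent_iff]
  intro c hc
  set a : In K 1 := ∑ k : Fin s, c k • (uu K z * (HEl K 1 0 - algebraMap K (In K 1) mu) ^ (k : ℕ)) with ha
  have hJ : a ∈ MslIdeal K s mu := by
    apply (Submodule.Quotient.mk_eq_zero _).1
    refine Eq.trans ?_ hc
    exact map_sum ((MslIdeal K s mu).mkQ.restrictScalars K) _ _
  obtain ⟨p, hp⟩ := J_good K mu s a hJ z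
  set q : Polynomial K := ∑ k : Fin s, Polynomial.C (c k) * Polynomial.X ^ (k : ℕ) with hq
  have hev : ∀ᶠ m : ℕ in Filter.atTop,
      q.eval ((m : K) + 1 - mu) = (Polynomial.X ^ s * p).eval ((m : K) + 1 - mu) := by
    filter_upwards [hp, LL_uu K z] with m h1 h2
    rw [← h1, ha, Finset.sum_smul, map_sum, hq, Polynomial.eval_finsetSum]
    refine Finset.sum_congr rfl fun k _ => ?_
    rw [smul_assoc, map_smul, mul_smul, Hpow_yy, ← smul_comm, map_smul, h2]
    simp
  have heq : q = Polynomial.X ^ s * p := by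
    apply Polynomial.eq_of_infinite_eval_eq
    obtain ⟨N, hN⟩ := Filter.eventually_atTop.1 hev
    refine Set.Infinite.mono (s := (fun m : ℕ => (m : K) + 1 - mu) '' Set.Ici N) ?_ ?_
    · rintro _ ⟨m, hm, rfl⟩
      exact hN m hm
    · refine (Set.Ici_infinite N).image (Function.Injective.injOn ?_)
      intro m m' h
      have : (m : K) = m' := by linear_combination h
      exact_mod_cast this
  intro k
  have h1 : q.coeff k = c k := by
    rw [hq, Polynomial.finsetSum_coeff, Finset.sum_eq_single k]
    · simp
    · intro j _ hj
      rw [Polynomial.coeff_C_mul, Polynomial.coeff_X_pow, if_neg (fun h => hj (Fin.ext h.symm)), mul_zero]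
    · simp
  rw [← h1, heq, Polynomial.coeff_X_pow_mul', if_neg (by omega)]

private lemma gws_indep (M : Type*) [AddCommGroup M] [Module K M] [Module (In K 1) M]
    [IsScalarTower K (In K 1) M] :
    iSupIndep (fun lam : Fin 1 → K => genWeightSpace K 1 M lam) := by
  have h := Module.End.independent_maxGenEigenspace (Algebra.lsmul K K M (HEl K 1 0))
  have h2 := h.comp (f := fun lam : Fin 1 → K => lam 0) (by
    intro a b hab; funext i; obtain rfl := Subsingleton.elim i 0; exact hab)
  convert h2 using 2 with lam
  ext m
  have key : ∀ N : ℕ, ((Algebra.lsmul K K M (HEl K 1 0) - lam 0 • (1 : Module.End K M)) ^ N) m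
      = ((HEl K 1 0 - algebraMap K (In K 1) (lam 0)) ^ N) • m := by
    intro N
    change _ = Algebra.lsmul K K M ((HEl K 1 0 - algebraMap K (In K 1) (lam 0)) ^ N) m
    rw [map_pow, map_sub, AlgHom.commutes, Algebra.algebraMap_eq_smul_one]
  simp only [Function.comp, Module.End.mem_maxGenEigenspace, key]
  constructor
  · rintro ⟨N, hN⟩; exact ⟨N, hN 0⟩
  · rintro ⟨N, hN⟩
    exact ⟨N, fun i => by obtain rfl := Subsingleton.elim i 0; exact hN⟩

end Proof2


/-- `M(s,λ)` is a generalized weight `𝕀_1`-module with support `λ + ℤ`, all of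
whose generalized weight spaces are `s`-dimensional. -/
theorem statement2 (K : Type*) [Field K] [CharZero K] (mu : K) (s : ℕ) (hs : 1 ≤ s) :
    IsGenWeightModule K 1 (Msl K s mu) ∧
    supp K 1 (Msl K s mu) = {nu : Fin 1 → K | ∃ z : ℤ, nu 0 = mu + (z : K)} ∧
    (∀ z : ℤ, Module.finrank K
      (genWeightSpace K 1 (Msl K s mu) (fun _ => mu + (z : K))) = s) := by
  have hind := gws_indep K (Msl K s mu)
  have htop := Mz_top K mu s
  have hle := Mz_le K mu s
  have hother : ∀ nu : Fin 1 → K, (¬ ∃ z : ℤ, nu 0 = mu + (z : K)) →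
      genWeightSpace K 1 (Msl K s mu) nu = ⊥ := by
    intro nu hnu
    have h1 := hind nu
    have h2 : (⨆ j, ⨆ (_ : j ≠ nu), genWeightSpace K 1 (Msl K s mu) j) = ⊤ := by
      rw [eq_top_iff, ← htop]
      refine iSup_le fun z => (hle z).trans ?_
      exact le_iSup₂_of_le (fun _ => mu + (z : K)) (fun h => hnu ⟨z, by rw [← h]⟩) le_rfl
    rw [h2] at h1
    exact disjoint_top.1 h1
  have heq : ∀ z : ℤ, genWeightSpace K 1 (Msl K s mu) (fun _ => mu + (z : K)) = Mz K mu s z := by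
    intro z
    have h1 := hind (fun _ => mu + (z : K))
    refine le_antisymm ?_ (hle z)
    have h2 : Mz K mu s z ⊔ (⨆ j, ⨆ (_ : j ≠ (fun _ : Fin 1 => mu + (z : K))),
        genWeightSpace K 1 (Msl K s mu) j) = ⊤ := by
      rw [eq_top_iff, ← htop]
      refine iSup_le fun w => ?_
      by_cases hw : w = z
      · subst hw; exact le_sup_left
      · refine le_sup_of_le_right ((hle w).trans ?_)
        refine le_iSup₂_of_le (fun _ => mu + (w : K)) (fun h => hw ?_) le_rfl
        have h3 := congrFun h 0
        have h4 : (w : K) = z := add_left_cancel h3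
        exact_mod_cast h4
    exact (eq_of_le_of_inf_le_of_sup_le (hle z)
      (by rw [h1.eq_bot]; exact bot_le) (by rw [h2]; exact le_top)).ge
  have hfin : ∀ z : ℤ, Module.finrank K
      (genWeightSpace K 1 (Msl K s mu) (fun _ => mu + (z : K))) = s := by
    intro z
    rw [heq, Mz, finrank_span_eq_card (ww_li K mu s z), Fintype.card_fin]
  refine ⟨?_, ?_, hfin⟩
  · unfold IsGenWeightModule
    refine (@DirectSum.isInternal_submodule_iff_iSupIndep_and_iSup_eq_top _ _ _ (Classical.decEq _)
      _ _ _ _).2 ⟨hind, ?_⟩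
    rw [eq_top_iff, ← htop]
    exact iSup_le fun z => (hle z).trans (le_iSup (genWeightSpace K 1 (Msl K s mu)) _)
  · ext nu
    constructor
    · intro h
      by_contra h2
      exact h (hother nu h2)
    · rintro ⟨z, hz⟩ h
      have h1 : nu = fun _ => mu + (z : K) := by
        funext i; obtain rfl := Subsingleton.elim i 0; exact hz
      have h2 := hfin z
      rw [← h1, h, finrank_bot] at h2
      omega

end IDO
end

section
/- For every orbit Ω ∈ K^n/ℤ^n, the category GW(𝕀_n, Ω) is the direct sum of its full subcategories GW(𝕀_n, 𝒟_Ω) taken over all subsets 𝒟_Ω ⊆ 𝔻_Ω: every generalized weight 𝕀_n-module M with Supp(M) ⊆ Ω decomposes uniquely as a direct sum M = ⊕_{𝒟_Ω ⊆ 𝔻_Ω} M_{𝒟_Ω} of submodules M_{𝒟_Ω} ∈ GW(𝕀_n, 𝒟_Ω). -/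
set_option maxHeartbeats 1000000
set_option synthInstance.maxHeartbeats 400000
set_option linter.unusedSectionVars false

namespace IDO

open scoped TensorProduct

namespace Aux

section Rel

variable {K : Type*} [Field K] [CharZero K] {n : ℕ}

lemma In_ext' {a b : In K n} (h : ∀ (α : Fin n →₀ ℕ),
    a • (MvPolynomial.monomial α 1 : P K n) = b • MvPolynomial.monomial α (1 : K)) : a = b := by
  have : (show InSub K n from a) = (show InSub K n from b) := by
    apply Subtype.ext
    apply (MvPolynomial.basisMonomials (Fin n) K).ext
    intro α
    have := h α
    rw [MvPolynomial.coe_basisMonomials]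
    exact this
  exact this

lemma smul_K_comm (a : In K n) (c : K) (p : P K n) : a • (c • p) = c • (a • p) := by
  exact smul_comm a c p

lemma int_mon (i : Fin n) (α : Fin n →₀ ℕ) :
    intEl K n i • (MvPolynomial.monomial α 1 : P K n)
      = (((α i : ℕ) : K) + 1)⁻¹ • MvPolynomial.monomial (α + Finsupp.single i 1) (1 : K) := by
  have h := (MvPolynomial.basisMonomials (Fin n) K).constr_basis K
    (fun α => (((α i : ℕ) : K) + 1)⁻¹ •
      (MvPolynomial.monomial (α + Finsupp.single i 1) (1 : K))) α
  rw [MvPolynomial.coe_basisMonomials] at h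
  exact h

lemma d_mon (i : Fin n) (α : Fin n →₀ ℕ) :
    dEl K n i • (MvPolynomial.monomial α 1 : P K n)
      = ((α i : ℕ) : K) • MvPolynomial.monomial (α - Finsupp.single i 1) (1 : K) := by
  rw [dEl_smul, MvPolynomial.pderiv_monomial, MvPolynomial.smul_monomial]
  simp

lemma x_mon (i : Fin n) (α : Fin n →₀ ℕ) :
    xEl K n i • (MvPolynomial.monomial α 1 : P K n)
      = MvPolynomial.monomial (α + Finsupp.single i 1) (1 : K) := by
  rw [xEl_smul, MvPolynomial.X, MvPolynomial.monomial_mul, one_mul, add_comm]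

lemma d_int (i : Fin n) : dEl K n i * intEl K n i = 1 := by
  apply In_ext'; intro α
  have : ((α i : ℕ) : K) + 1 ≠ 0 := Nat.cast_add_one_ne_zero _
  rw [mul_smul, int_mon, smul_K_comm, d_mon, one_smul, smul_smul]
  simp [this]

lemma d_x (i : Fin n) : dEl K n i * xEl K n i = HEl K n i := rfl

lemma H_mon (i : Fin n) (α : Fin n →₀ ℕ) :
    HEl K n i • (MvPolynomial.monomial α 1 : P K n)
      = (((α i : ℕ) : K) + 1) • MvPolynomial.monomial α (1 : K) := hEl_monomial K n i α 1

lemma x_eq (i : Fin n) : xEl K n i = intEl K n i * HEl K n i := by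
  apply In_ext'; intro α
  have : ((α i : ℕ) : K) + 1 ≠ 0 := Nat.cast_add_one_ne_zero _
  rw [mul_smul, H_mon, smul_K_comm, int_mon, smul_smul, x_mon, mul_inv_cancel₀ this, one_smul]

lemma H_int (i : Fin n) : HEl K n i * intEl K n i = intEl K n i * HEl K n i + intEl K n i := by
  apply In_ext'; intro α
  rw [add_smul, mul_smul, mul_smul, H_mon, smul_K_comm, int_mon, smul_K_comm, H_mon, smul_smul,
    smul_smul, ← add_smul]
  congr 1
  simp
  ring

lemma H_d (i : Fin n) : HEl K n i * dEl K n i = dEl K n i * HEl K n i - dEl K n i := by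
  apply In_ext'; intro α
  rw [sub_smul, mul_smul, mul_smul, H_mon, smul_K_comm, d_mon, smul_K_comm, H_mon, smul_smul,
    smul_smul, ← sub_smul]
  congr 1
  rcases Nat.eq_zero_or_pos (α i) with h | h
  · simp [h]
  · simp [Nat.cast_sub h]; ring

lemma H_eq (i : Fin n) : HEl K n i = xEl K n i * dEl K n i + 1 := by
  apply In_ext'; intro α
  rw [add_smul, mul_smul, H_mon, one_smul, d_mon, smul_K_comm, x_mon, add_smul, one_smul]
  congr 1
  rcases Nat.eq_zero_or_pos (α i) with h | h
  · simp [h]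
  · congr 2
    rw [tsub_add_cancel_of_le]
    rw [Finsupp.single_le_iff]; exact h

lemma cd_d (i j : Fin n) : dEl K n i * dEl K n j = dEl K n j * dEl K n i := by
  by_cases hij : i = j
  · rw [hij]
  apply In_ext'; intro α
  rw [mul_smul, mul_smul, d_mon, d_mon, smul_K_comm, d_mon, smul_K_comm, d_mon, smul_smul,
    smul_smul, tsub_tsub, tsub_tsub, add_comm (Finsupp.single j 1)]
  congr 1
  simp [Finsupp.single_apply, hij, Ne.symm hij, eq_comm, mul_comm]

lemma cint_int (i j : Fin n) : intEl K n i * intEl K n j = intEl K n j * intEl K n i := by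
  by_cases hij : i = j
  · rw [hij]
  apply In_ext'; intro α
  rw [mul_smul, mul_smul, int_mon, int_mon, smul_K_comm, int_mon, smul_K_comm, int_mon, smul_smul,
    smul_smul, add_assoc, add_assoc, add_comm (Finsupp.single j 1)]
  congr 1
  simp [Finsupp.single_apply, hij, Ne.symm hij, eq_comm, mul_comm]

lemma cd_int {i j : Fin n} (hij : i ≠ j) :
    dEl K n i * intEl K n j = intEl K n j * dEl K n i := by
  apply In_ext'; intro α
  rw [mul_smul, mul_smul, int_mon, d_mon, smul_K_comm, d_mon, smul_K_comm, int_mon, smul_smul,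
    smul_smul]
  have h1 : α + Finsupp.single j 1 - Finsupp.single i 1
    = α - Finsupp.single i 1 + Finsupp.single j 1 := by
    ext k
    simp only [Finsupp.coe_tsub, Finsupp.coe_add, Pi.sub_apply, Pi.add_apply, Finsupp.single_apply]
    by_cases h : i = k
    · subst h; simp [Ne.symm hij]
    · simp [h]
  rw [h1]
  congr 1
  simp [Finsupp.single_apply, hij, Ne.symm hij, eq_comm, mul_comm]

lemma cH_int {i j : Fin n} (hij : i ≠ j) :
    HEl K n i * intEl K n j = intEl K n j * HEl K n i := by
  apply In_ext'; intro α
  rw [mul_smul, mul_smul, int_mon, H_mon, smul_K_comm, H_mon, smul_K_comm, int_mon, smul_smul,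
    smul_smul]
  congr 1
  simp [Finsupp.single_apply, hij, Ne.symm hij, eq_comm, mul_comm]

lemma cH_d {i j : Fin n} (hij : i ≠ j) :
    HEl K n i * dEl K n j = dEl K n j * HEl K n i := by
  apply In_ext'; intro α
  rw [mul_smul, mul_smul, d_mon, H_mon, smul_K_comm, H_mon, smul_K_comm, d_mon, smul_smul,
    smul_smul]
  congr 1
  simp [Finsupp.single_apply, hij, Ne.symm hij, eq_comm, mul_comm]

/-- The idempotent `e_{00}(i) = 1 - ∫_i ∂_i`. -/
noncomputable def e0 (K : Type*) [Field K] [CharZero K] {n : ℕ} (i : Fin n) : In K n :=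
  1 - intEl K n i * dEl K n i

lemma e0_int (i : Fin n) : e0 K i * intEl K n i = 0 := by
  rw [e0, sub_mul, mul_assoc, d_int]; simp

lemma d_e0 (i : Fin n) : dEl K n i * e0 K i = 0 := by
  rw [e0, mul_sub, ← mul_assoc, d_int]; simp

lemma e0_x (i : Fin n) : e0 K i * xEl K n i = 0 := by
  rw [x_eq, ← mul_assoc, e0_int, zero_mul]

lemma H_e0 (i : Fin n) : HEl K n i * e0 K i = e0 K i := by
  conv_lhs => rw [H_eq]
  rw [add_mul, mul_assoc, d_e0]; simp

lemma e0_H (i : Fin n) : e0 K i * HEl K n i = e0 K i := by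
  rw [H_eq, mul_add, ← mul_assoc, e0_x]; simp

lemma dpow_int (i : Fin n) (s : ℕ) : dEl K n i ^ (s+1) * intEl K n i = dEl K n i ^ s := by
  rw [pow_succ, mul_assoc, d_int, mul_one]

lemma dpow_intpow (i : Fin n) (s : ℕ) : dEl K n i ^ s * intEl K n i ^ s = 1 := by
  induction s with
  | zero => simp
  | succ s ih => rw [pow_succ, pow_succ', mul_assoc, ← mul_assoc (dEl K n i), d_int, one_mul, ih]

lemma dpow_x (i : Fin n) (s : ℕ) :
    dEl K n i ^ (s+1) * xEl K n i = xEl K n i * dEl K n i ^ (s+1) + ((s:In K n)+1) * dEl K n i ^ s := by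
  induction s with
  | zero => rw [zero_add, pow_one, d_x, H_eq]; simp
  | succ s ih =>
    have hc : dEl K n i * ((s:In K n)+1) = ((s:In K n)+1) * dEl K n i := by
      rw [mul_add, add_mul, Nat.cast_commute s (dEl K n i)]; simp
    rw [pow_succ', mul_assoc, ih, mul_add, ← mul_assoc, d_x, H_eq, ← mul_assoc, hc, mul_assoc,
      ← pow_succ', add_mul, mul_assoc, ← pow_succ', one_mul]
    push_cast
    noncomm_ring

/-- Induction principle for `𝕀_n`. -/
lemma In_induct (S : Subalgebra K (In K n)) (hx : ∀ i, xEl K n i ∈ S)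
    (hd : ∀ i, dEl K n i ∈ S) (hi : ∀ i, intEl K n i ∈ S)
    (a : In K n) : a ∈ S := by
  obtain ⟨a, ha⟩ := a
  refine Algebra.adjoin_induction (p := fun x hx => (⟨x, hx⟩ : InSub K n) ∈
    (show Subalgebra K (InSub K n) from S)) ?_ ?_ ?_ ?_ ha
  · rintro x ((⟨i, rfl⟩ | ⟨i, rfl⟩) | ⟨i, rfl⟩)
    · exact hx i
    · exact hd i
    · exact hi i
  · intro r
    exact S.algebraMap_mem r
  · intro x y hx hy h1 h2
    exact S.add_mem h1 h2
  · intro x y hx hy h1 h2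
    exact S.mul_mem h1 h2

lemma K_smul_eq {M : Type*} [AddCommGroup M] [Module K M] [Module (In K n) M]
    [IsScalarTower K (In K n) M] (c : K) (m : M) : c • m = algebraMap K (In K n) c • m := by
  rw [algebraMap_smul]

/-- A `K`-subspace stable under the generators is stable under `𝕀_n`. -/
lemma stable_of_gens {M : Type*} [AddCommGroup M] [Module K M] [Module (In K n) M]
    [IsScalarTower K (In K n) M] (N : Submodule K M)
    (hx : ∀ i, ∀ m ∈ N, xEl K n i • m ∈ N)
    (hd : ∀ i, ∀ m ∈ N, dEl K n i • m ∈ N) (hi : ∀ i, ∀ m ∈ N, intEl K n i • m ∈ N)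
    (a : In K n) : ∀ m ∈ N, a • m ∈ N := by
  let S : Subalgebra K (In K n) :=
    { carrier := {a | ∀ m ∈ N, a • m ∈ N}
      mul_mem' := by
        intro a b ha hb m hm
        rw [mul_smul]; exact ha _ (hb _ hm)
      add_mem' := by
        intro a b ha hb m hm
        rw [add_smul]; exact N.add_mem (ha _ hm) (hb _ hm)
      algebraMap_mem' := by
        intro c m hm
        rw [← K_smul_eq]; exact N.smul_mem c hm }
  exact In_induct S hx hd hi a

/-- The `𝕀_n`-submodule given by a `K`-subspace stable under the generators. -/
def mkSub {M : Type*} [AddCommGroup M] [Module K M] [Module (In K n) M]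
    [IsScalarTower K (In K n) M] (N : Submodule K M)
    (hx : ∀ i, ∀ m ∈ N, xEl K n i • m ∈ N)
    (hd : ∀ i, ∀ m ∈ N, dEl K n i • m ∈ N) (hi : ∀ i, ∀ m ∈ N, intEl K n i • m ∈ N) :
    Submodule (In K n) M :=
  { N.toAddSubmonoid with
    smul_mem' := fun a m hm => stable_of_gens N hx hd hi a m hm }

lemma cd_H {i j : Fin n} (hij : i ≠ j) : Commute (dEl K n i) (HEl K n j) :=
  (cH_d hij.symm).symm

lemma cd_x {i j : Fin n} (hij : i ≠ j) : Commute (dEl K n i) (xEl K n j) := by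
  rw [x_eq]; exact Commute.mul_right (cd_int hij) (cd_H hij)

lemma cint_x {i j : Fin n} (hij : i ≠ j) : Commute (intEl K n i) (xEl K n j) := by
  rw [x_eq]; exact Commute.mul_right (cint_int i j) (cH_int hij.symm).symm

lemma e0_comm {i : Fin n} {b : In K n} (h1 : Commute (dEl K n i) b) (h2 : Commute (intEl K n i) b) :
    Commute (e0 K i) b := by
  rw [e0]
  exact Commute.sub_left (Commute.one_left _) (Commute.mul_left h2 h1)

/-- elements `e_{00} ∂^s` -/
lemma f_H (i : Fin n) (s : ℕ) :
    e0 K i * dEl K n i ^ s * HEl K n i = ((s : In K n) + 1) * (e0 K i * dEl K n i ^ s) := by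
  have h : dEl K n i ^ s * HEl K n i = HEl K n i * dEl K n i ^ s + (s : In K n) * dEl K n i ^ s := by
    induction s with
    | zero => simp
    | succ s ih =>
      have h0 : dEl K n i * HEl K n i = HEl K n i * dEl K n i + dEl K n i := by
        rw [H_d]; abel
      rw [pow_succ', mul_assoc, ih, mul_add, ← mul_assoc, h0, ← mul_assoc,
        ← Nat.cast_commute s (dEl K n i)]
      push_cast
      noncomm_ring
  rw [mul_assoc, h, mul_add, ← mul_assoc, e0_H, ← mul_assoc, ← Nat.cast_commute s (e0 K i)]
  noncomm_ring

end Rel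


section AB

variable {K : Type*} [Field K] [CharZero K] {n : ℕ}
  {M : Type*} [AddCommGroup M] [Module K M] [Module (In K n) M] [IsScalarTower K (In K n) M]

lemma dpow_smul_mono {i : Fin n} {m : M} {s s' : ℕ}
    (h : (dEl K n i ^ s) • m = 0) (hle : s ≤ s') : (dEl K n i ^ s') • m = 0 := by
  obtain ⟨k, rfl⟩ := Nat.exists_eq_add_of_le hle
  rw [add_comm s k, pow_add, mul_smul, h, smul_zero]

lemma comm_smul {a b : In K n} (h : Commute a b) (m : M) : a • b • m = b • a • m := by
  rw [← mul_smul, h.eq, mul_smul]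

variable (K M) in
/-- Vectors on which `∂_i` is nilpotent. -/
def Asub (i : Fin n) : Submodule (In K n) M :=
  mkSub (K := K)
    { carrier := {m | ∃ k : ℕ, (dEl K n i ^ k) • m = 0}
      add_mem' := by
        rintro a b ⟨k, hk⟩ ⟨l, hl⟩
        refine ⟨k ⊔ l, ?_⟩
        rw [smul_add, dpow_smul_mono hk le_sup_left, dpow_smul_mono hl le_sup_right, add_zero]
      zero_mem' := ⟨0, smul_zero _⟩
      smul_mem' := by
        rintro c m ⟨k, hk⟩
        exact ⟨k, by rw [← smul_comm c _ m, hk, smul_zero]⟩ }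
    (by
      rintro j m ⟨k, hk⟩
      by_cases hij : i = j
      · subst hij
        refine ⟨k + 1, ?_⟩
        rw [← mul_smul, dpow_x, add_smul, mul_smul, mul_smul, hk,
          dpow_smul_mono hk (Nat.le_succ k)]
        simp
      · refine ⟨k, ?_⟩
        rw [comm_smul ((cd_x hij).pow_left k), hk, smul_zero])
    (by
      rintro j m ⟨k, hk⟩
      refine ⟨k, ?_⟩
      rw [comm_smul (Commute.pow_left (cd_d i j) k), hk, smul_zero])
    (by
      rintro j m ⟨k, hk⟩
      by_cases hij : i = j
      · subst hij
        refine ⟨k + 1, ?_⟩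
        rw [← mul_smul, dpow_int, hk]
      · refine ⟨k, ?_⟩
        rw [comm_smul (Commute.pow_left (cd_int hij) k), hk, smul_zero])

lemma mem_Asub {i : Fin n} {m : M} : m ∈ Asub K M i ↔ ∃ k : ℕ, (dEl K n i ^ k) • m = 0 := Iff.rfl

lemma f_comm {i j : Fin n} {b : In K n} (s : ℕ) (h1 : Commute (dEl K n i) b)
    (h2 : Commute (intEl K n i) b) : Commute (e0 K i * dEl K n i ^ s) b :=
  Commute.mul_left (e0_comm h1 h2) (h1.pow_left s)

variable (K M) in
/-- Vectors killed by all the `e_{00}(i)∂_i^s`. -/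
def Bsub (i : Fin n) : Submodule (In K n) M :=
  mkSub (K := K)
    { carrier := {m | ∀ s : ℕ, (e0 K i * dEl K n i ^ s) • m = 0}
      add_mem' := by
        intro a b ha hb s
        rw [smul_add, ha, hb, add_zero]
      zero_mem' := fun s => smul_zero _
      smul_mem' := by
        intro c m h s
        rw [← smul_comm c _ m, h, smul_zero] }
    (by
      intro j m h s
      by_cases hij : i = j
      · subst hij
        cases s with
        | zero => rw [← mul_smul, pow_zero, mul_one, e0_x, zero_smul]
        | succ s =>
          rw [← mul_smul, mul_assoc, dpow_x, mul_add, ← mul_assoc, e0_x, zero_mul, zero_add,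
            ← mul_assoc, ← Nat.cast_succ, ← Nat.cast_commute, mul_assoc, mul_smul, h, smul_zero]
      · rw [comm_smul (f_comm (j := j) s (cd_x hij) (cint_x hij)), h, smul_zero])
    (by
      intro j m h s
      by_cases hij : i = j
      · subst hij
        rw [← mul_smul, mul_assoc, ← pow_succ, h]
      · rw [comm_smul (f_comm (j := j) s (cd_d i j) (cd_int (Ne.symm hij)).symm), h, smul_zero])
    (by
      intro j m h s
      by_cases hij : i = j
      · subst hij
        cases s with
        | zero => rw [← mul_smul, pow_zero, mul_one, e0_int, zero_smul]
        | succ s =>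
          rw [← mul_smul, mul_assoc, dpow_int, h]
      · rw [comm_smul (f_comm (j := j) s (cd_int hij) (cint_int i j)), h, smul_zero])

lemma mem_Bsub {i : Fin n} {m : M} :
    m ∈ Bsub K M i ↔ ∀ s : ℕ, (e0 K i * dEl K n i ^ s) • m = 0 := Iff.rfl

lemma AB_zero {i : Fin n} {m : M} (hA : m ∈ Asub K M i) (hB : m ∈ Bsub K M i) : m = 0 := by
  obtain ⟨k, hk⟩ := hA
  induction k with
  | zero => simpa using hk
  | succ k ih =>
    apply ih
    have h := hB k
    rw [mul_smul, e0, sub_smul, one_smul, mul_smul, ← mul_smul (dEl K n i), ← pow_succ', hk,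
      smul_zero, sub_zero] at h
    exact h

variable (K n M) in
/-- Local finiteness of the `e_{00}(i)∂_i^s`. -/
def SFin : Prop := ∀ (i : Fin n) (x : M), ∃ N : ℕ, ∀ s, N ≤ s → (e0 K i * dEl K n i ^ s) • x = 0

lemma AB_split (h : SFin K n M) (i : Fin n) (X : Submodule (In K n) M) (x : M) (hx : x ∈ X) :
    ∃ y z, y ∈ X ∧ z ∈ X ∧ y ∈ Asub K M i ∧ z ∈ Bsub K M i ∧ x = y + z := by
  obtain ⟨N, hN⟩ := h i x
  have hz : (intEl K n i ^ N * dEl K n i ^ N) • x ∈ X := X.smul_mem _ hx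
  refine ⟨x - (intEl K n i ^ N * dEl K n i ^ N) • x, (intEl K n i ^ N * dEl K n i ^ N) • x,
    X.sub_mem hx hz, hz, ⟨N, ?_⟩, ?_, by abel⟩
  · rw [smul_sub, ← mul_smul, ← mul_assoc, dpow_intpow, one_mul, sub_self]
  · intro s
    rcases lt_or_ge s N with hs | hs
    · obtain ⟨k, rfl⟩ := Nat.exists_eq_add_of_lt hs
      have : dEl K n i ^ s * intEl K n i ^ (s + k + 1) = intEl K n i ^ (k+1) := by
        rw [add_assoc, pow_add, ← mul_assoc, dpow_intpow, one_mul]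
      rw [← mul_smul, ← mul_assoc, mul_assoc (e0 K i), this, pow_succ', ← mul_assoc (e0 K i),
        e0_int, zero_mul, zero_mul, zero_smul]
    · obtain ⟨k, rfl⟩ := Nat.exists_eq_add_of_le hs
      have : dEl K n i ^ (N + k) * (intEl K n i ^ N * dEl K n i ^ N) = dEl K n i ^ (N + k) := by
        rw [add_comm, pow_add, mul_assoc, ← mul_assoc _ (intEl K n i ^ N), dpow_intpow, one_mul]
      rw [← mul_smul, mul_assoc, this]
      exact hN _ hs

variable (K M) in
/-- the `i`-th factor. -/
noncomputable def Csub (D : Set (Fin n)) (i : Fin n) : Submodule (In K n) M :=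
  open Classical in if i ∈ D then Asub K M i else Bsub K M i

variable (K M) in
/-- The summand attached to `D`. -/
noncomputable def ND (D : Set (Fin n)) : Submodule (In K n) M := ⨅ i, Csub K M D i

lemma Csub_compl_zero {D : Set (Fin n)} {i : Fin n} {m : M} (h1 : m ∈ Csub K M D i)
    (h2 : m ∈ Csub K M Dᶜ i) : m = 0 := by
  unfold Csub at h1 h2
  by_cases h : i ∈ D
  · simp only [h, Set.mem_compl_iff, if_true, not_true_eq_false, if_false] at h1 h2
    exact AB_zero h1 h2
  · simp only [h, Set.mem_compl_iff, not_false_eq_true, if_true, if_false] at h1 h2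
    exact AB_zero h2 h1

lemma Csub_split (h : SFin K n M) (D : Set (Fin n)) (i : Fin n) (X : Submodule (In K n) M) (x : M)
    (hx : x ∈ X) :
    ∃ y z, y ∈ X ∧ z ∈ X ∧ y ∈ Csub K M D i ∧ z ∈ Csub K M Dᶜ i ∧ x = y + z := by
  obtain ⟨y, z, hy, hz, hA, hB, e⟩ := AB_split h i X x hx
  unfold Csub
  by_cases h : i ∈ D
  · simp only [h, Set.mem_compl_iff, if_true, not_true_eq_false, if_false]
    exact ⟨y, z, hy, hz, hA, hB, e⟩
  · simp only [h, Set.mem_compl_iff, not_false_eq_true, if_true, if_false]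
    exact ⟨z, y, hz, hy, hB, hA, by rw [e, add_comm]⟩

lemma Csub_congr {D D' : Set (Fin n)} {i : Fin n} (h : i ∈ D ↔ i ∈ D') :
    Csub K M D i = Csub K M D' i := by
  classical
  unfold Csub
  by_cases h1 : i ∈ D
  · rw [if_pos h1, if_pos (h.1 h1)]
  · rw [if_neg h1, if_neg (fun h2 => h1 (h.2 h2))]

lemma ND_disj_aux (h : SFin K n M) (D : Set (Fin n)) (s : Finset (Fin n)) :
    ∀ x ∈ ND K M D, x ∈ s.sup (fun i => Csub K M Dᶜ i) → x = 0 := by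
  induction s using Finset.induction_on with
  | empty => intro x _ hx; simpa using hx
  | insert j s hj ih =>
    intro x hx hx'
    rw [Finset.sup_insert, Submodule.mem_sup] at hx'
    obtain ⟨c, hc, y, hy, e⟩ := hx'
    obtain ⟨y1, y2, h1, h2, hy1, hy2, e2⟩ := Csub_split h D j _ y hy
    have hxj : x ∈ Csub K M D j := (Submodule.mem_iInf _).1 hx j
    have : x - y1 = 0 := by
      apply Csub_compl_zero (D := D) (i := j) (Submodule.sub_mem _ hxj hy1)
      have : x - y1 = c + y2 := by rw [← e, e2]; abel
      rw [this]
      exact Submodule.add_mem _ hc hy2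
    apply ih x hx
    rw [sub_eq_zero.1 this]; exact h1

lemma ND_indep (h : SFin K n M) : iSupIndep (ND K M (n := n)) := by
  intro D
  rw [Submodule.disjoint_def]
  intro x hx hx'
  apply ND_disj_aux h D Finset.univ x hx
  refine (iSup₂_le ?_ : (⨆ D', ⨆ (_ : D' ≠ D), ND K M D') ≤ _) hx'
  intro D' hD
  have : ∃ i, ¬ (i ∈ D' ↔ i ∈ D) := by
    by_contra! hc
    exact hD (Set.ext hc)
  obtain ⟨i, hi⟩ := this
  have h1 : Csub K M D' i = Csub K M Dᶜ i := Csub_congr (by simp only [Set.mem_compl_iff]; tauto)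
  calc ND K M D' ≤ Csub K M D' i := iInf_le _ i
    _ = Csub K M Dᶜ i := h1
    _ ≤ _ := Finset.le_sup (f := fun i => Csub K M Dᶜ i) (Finset.mem_univ i)

lemma ND_top_aux (h : SFin K n M) (s : Finset (Fin n)) :
    (⨆ D : Set (Fin n), s.inf (fun i => Csub K M D i)) = ⊤ := by
  induction s using Finset.induction_on with
  | empty => simp
  | insert j s hj ih =>
    rw [eq_top_iff, ← ih]
    apply iSup_le
    intro D x hx
    obtain ⟨y, z, hy, hz, hA, hB, rfl⟩ := AB_split h j _ x hx
    apply Submodule.add_mem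
    · refine (le_iSup (fun D : Set (Fin n) => (insert j s).inf (fun i => Csub K M D i))
        (insert j D)) ?_
      rw [Finset.inf_insert]
      refine ⟨?_, ?_⟩
      · simpa [Csub] using hA
      · have : s.inf (fun i => Csub K M (insert j D) i) = s.inf (fun i => Csub K M D i) := by
          apply Finset.inf_congr rfl
          intro i hi
          apply Csub_congr
          have : i ≠ j := by rintro rfl; exact hj hi
          simp [this]
        rw [this]; exact hy
    · refine (le_iSup (fun D : Set (Fin n) => (insert j s).inf (fun i => Csub K M D i))
        (D \ {j})) ?_
      rw [Finset.inf_insert]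
      refine ⟨?_, ?_⟩
      · simpa [Csub] using hB
      · have : s.inf (fun i => Csub K M (D \ {j}) i) = s.inf (fun i => Csub K M D i) := by
          apply Finset.inf_congr rfl
          intro i hi
          apply Csub_congr
          have : i ≠ j := by rintro rfl; exact hj hi
          simp [this]
        rw [this]; exact hz

lemma ND_top (h : SFin K n M) : (⨆ D, ND K M (n := n) D) = ⊤ := by
  have := ND_top_aux h (M := M) Finset.univ
  simpa [ND, Finset.inf_univ_eq_iInf] using this

end AB

section Gen

variable (K : Type*) [Field K] [CharZero K] (n : ℕ)
  (M : Type*) [AddCommGroup M] [Module K M] [Module (In K n) M] [IsScalarTower K (In K n) M]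

lemma pow_sub_smul (i : Fin n) (c : K) (N : ℕ) (m : M) :
    ((HEl K n i - algebraMap K (In K n) c) ^ N) • m =
      (((DistribSMul.toLinearMap K M (HEl K n i) : Module.End K M)
        - algebraMap K (Module.End K M) c) ^ N) m := by
  induction N generalizing m with
  | zero => simp
  | succ N ih =>
    rw [pow_succ, mul_smul, ih, pow_succ, Module.End.mul_apply]
    congr 1
    rw [sub_smul, algebraMap_smul]
    rfl

lemma genWS_le (lam : Fin n → K) : genWeightSpace K n M lam ≤
    ⨅ i, Module.End.maxGenEigenspace (DistribSMul.toLinearMap K M (HEl K n i) : Module.End K M)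
      (lam i) := by
  rintro m ⟨N, hN⟩
  rw [Submodule.mem_iInf]
  intro i
  rw [Module.End.mem_maxGenEigenspace]
  refine ⟨N, ?_⟩
  rw [← Algebra.algebraMap_eq_smul_one, ← pow_sub_smul]
  exact hN i

lemma genWS_indep : iSupIndep (genWeightSpace K n M) := by
  refine iSupIndep.mono ?_ (genWS_le K n M)
  apply Module.End.independent_iInf_maxGenEigenspace_of_forall_mapsTo
  intro i j c
  apply Module.End.mapsTo_maxGenEigenspace_of_comm
  ext m
  show HEl K n j • HEl K n i • m = HEl K n i • HEl K n j • m
  rw [← mul_smul, ← mul_smul, hEl_comm]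

lemma isInternal_iff' {R ι M : Type*} [Ring R] [AddCommGroup M] [Module R M]
    (dec : DecidableEq ι) (A : ι → Submodule R M) :
    DirectSum.IsInternal A ↔ iSupIndep A ∧ iSup A = ⊤ :=
  DirectSum.isInternal_submodule_iff_iSupIndep_and_iSup_eq_top A

lemma isGen_iff : IsGenWeightModule K n M ↔ (⨆ lam, genWeightSpace K n M lam) = ⊤ := by
  unfold IsGenWeightModule
  letI := Classical.decEq (Fin n → K)
  refine Iff.trans (isInternal_iff' _ _) ?_
  exact ⟨fun h => h.2, fun h => ⟨genWS_indep K n M, h⟩⟩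

/-- Generalized weight with weights in a given set. -/
def Good (O : Set (Fin n → K)) : Prop := (⨆ lam ∈ O, genWeightSpace K n M lam) = ⊤

lemma good_of (O : Set (Fin n → K)) (h : IsGenWeightModule K n M) (h2 : supp K n M ⊆ O) :
    Good K n M O := by
  rw [isGen_iff] at h
  rw [Good, eq_top_iff, ← h]
  apply iSup_le
  intro lam
  by_cases hl : lam ∈ O
  · exact le_iSup₂_of_le lam hl le_rfl
  · have : genWeightSpace K n M lam = ⊥ := by
      by_contra hc
      exact hl (h2 hc)
    rw [this]; exact bot_le

lemma Good.isGen {O : Set (Fin n → K)} (h : Good K n M O) : IsGenWeightModule K n M := by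
  rw [isGen_iff, eq_top_iff, ← h]
  exact iSup₂_le fun lam _ => le_iSup (genWeightSpace K n M) lam

lemma Good.supp {O : Set (Fin n → K)} (h : Good K n M O) : supp K n M ⊆ O := by
  intro lam hl
  by_contra hc
  apply hl
  have h1 := genWS_indep K n M lam
  have h2 : (⨆ j, ⨆ (_ : j ≠ lam), genWeightSpace K n M j) = ⊤ := by
    rw [eq_top_iff, ← h]
    refine iSup₂_le fun mu hmu => le_iSup₂_of_le mu ?_ le_rfl
    rintro rfl; exact hc hmu
  rw [h2] at h1
  exact disjoint_top.1 h1

variable {K n M}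

lemma genWS_map {M' : Type*} [AddCommGroup M'] [Module K M'] [Module (In K n) M']
    [IsScalarTower K (In K n) M'] (f : M →ₗ[In K n] M') {lam : Fin n → K} {m : M}
    (hm : m ∈ genWeightSpace K n M lam) : f m ∈ genWeightSpace K n M' lam := by
  obtain ⟨N, hN⟩ := hm
  exact ⟨N, fun i => by rw [← map_smul, hN i, map_zero]⟩

lemma genWS_map_inj {M' : Type*} [AddCommGroup M'] [Module K M'] [Module (In K n) M']
    [IsScalarTower K (In K n) M'] (f : M →ₗ[In K n] M') (hf : Function.Injective f)
    {lam : Fin n → K} {m : M}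
    (hm : f m ∈ genWeightSpace K n M' lam) : m ∈ genWeightSpace K n M lam := by
  obtain ⟨N, hN⟩ := hm
  exact ⟨N, fun i => hf (by rw [map_smul, hN i, map_zero])⟩

lemma Good.exists_sum {O : Set (Fin n → K)} (h : Good K n M O) (x : M) :
    ∃ (s : Finset (Fin n → K)) (c : (Fin n → K) → M), (∀ l ∈ s, l ∈ O) ∧
      (∀ l, c l ∈ genWeightSpace K n M l) ∧ x = ∑ l ∈ s, c l := by
  classical
  have hx : x ∈ (⨆ lam ∈ O, genWeightSpace K n M lam) := by rw [h]; trivial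
  rw [← iSup_subtype'' , Submodule.mem_iSup_iff_exists_finsupp] at hx
  obtain ⟨f, hf, hx⟩ := hx
  refine ⟨f.support.map (Function.Embedding.subtype _),
    fun l => if hl : l ∈ O then f ⟨l, hl⟩ else 0, ?_, ?_, ?_⟩
  · intro l hl
    simp only [Finset.mem_map] at hl
    obtain ⟨a, _, rfl⟩ := hl
    exact a.2
  · intro l
    by_cases hl : l ∈ O
    · simp only [hl, dif_pos]; exact hf ⟨l, hl⟩
    · simp only [hl, dif_neg, not_false_eq_true]; exact Submodule.zero_mem _
  · rw [Finset.sum_map, ← hx, Finsupp.sum]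
    apply Finset.sum_congr rfl
    intro a _
    simp

lemma Good.surj {O : Set (Fin n → K)} (h : Good K n M O) {M' : Type*} [AddCommGroup M']
    [Module K M'] [Module (In K n) M']
    [IsScalarTower K (In K n) M'] (f : M →ₗ[In K n] M') (hf : Function.Surjective f) :
    Good K n M' O := by
  rw [Good, eq_top_iff]
  intro y _
  obtain ⟨x, rfl⟩ := hf y
  obtain ⟨s, c, hs, hc, rfl⟩ := h.exists_sum x
  rw [map_sum]
  apply Submodule.sum_mem
  intro l hl
  exact (le_iSup₂_of_le (f := fun lam (_ : lam ∈ O) => genWeightSpace K n M' lam) l (hs l hl) le_rfl)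
    (genWS_map f (hc l))

lemma Good.sub {O : Set (Fin n → K)} (h : Good K n M O) (X : Submodule (In K n) M) :
    Good K n X O := by
  rw [Good, eq_top_iff]
  rintro ⟨x, hx⟩ _
  obtain ⟨s, c, hs, hc, e⟩ := h.exists_sum x
  have h0 : ∑ l ∈ s, X.mkQ (c l) = 0 := by
    rw [← map_sum, ← e]; simpa using hx
  have hz : ∀ l ∈ s, X.mkQ (c l) = 0 := by
    classical
    intro l hl
    refine (Submodule.disjoint_def.1 (genWS_indep K n (M ⧸ X) l)) _ (genWS_map X.mkQ (hc l)) ?_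
    rw [← Finset.add_sum_erase s _ hl, add_eq_zero_iff_eq_neg] at h0
    rw [h0]
    refine Submodule.neg_mem _ (Submodule.sum_mem _ fun j hj => ?_)
    exact (le_iSup₂_of_le (f := fun j (_ : j ≠ l) => genWeightSpace K n (M ⧸ X) j) j
      (Finset.ne_of_mem_erase hj) le_rfl) (genWS_map X.mkQ (hc j))
  have hX : ∀ l ∈ s, c l ∈ X := fun l hl => by simpa using hz l hl
  have e2 : (⟨x, hx⟩ : X) = ∑ l ∈ s.attach, ⟨c l, hX l l.2⟩ := by
    apply Subtype.ext
    rw [AddSubmonoidClass.coe_finset_sum]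
    simp only
    rw [Finset.sum_attach s c, e]
  rw [e2]
  apply Submodule.sum_mem
  intro l _
  refine (le_iSup₂_of_le (f := fun lam (_ : lam ∈ O) => genWeightSpace K n X lam) l.1 (hs l l.2) le_rfl)
    (genWS_map_inj X.subtype X.injective_subtype (hc l))

lemma eq_zero_of_pow_eq_zero' {x : K} {N : ℕ} (h : x ^ N = 0) : x = 0 := by
  by_contra hx
  exact pow_ne_zero N hx h

lemma f_genWS {i : Fin n} {lam : Fin n → K} {m : M} (hm : m ∈ genWeightSpace K n M lam) (s : ℕ)
    (hs : lam i ≠ s + 1) : (e0 K i * dEl K n i ^ s) • m = 0 := by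
  obtain ⟨N, hN⟩ := hm
  have key : ∀ N : ℕ, (e0 K i * dEl K n i ^ s) * (HEl K n i - algebraMap K (In K n) (lam i)) ^ N
      = algebraMap K (In K n) ((s + 1 - lam i) ^ N) * (e0 K i * dEl K n i ^ s) := by
    intro N
    induction N with
    | zero => simp
    | succ N ih =>
      rw [pow_succ, ← mul_assoc, ih, mul_assoc, mul_sub, f_H, ← Algebra.commutes, ← sub_mul,
        ← mul_assoc, pow_succ (s + 1 - lam i), map_mul]
      congr 2
      simp
  have h := congrArg (fun a => a • m) (key N)
  simp only [mul_smul, hN i, smul_zero] at h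
  rw [algebraMap_smul] at h
  rcases smul_eq_zero.1 h.symm with h | h
  · exact absurd (sub_eq_zero.1 (eq_zero_of_pow_eq_zero' h)).symm hs
  · rw [mul_smul]; exact h

lemma Good.sfin {O : Set (Fin n → K)} (h : Good K n M O) : SFin K n M := by
  intro i x
  obtain ⟨s, c, hs, hc, rfl⟩ := h.exists_sum x
  have : ∀ l ∈ s, ∃ N : ℕ, ∀ t, N ≤ t → (e0 K i * dEl K n i ^ t) • c l = 0 := by
    intro l _
    by_cases hl : ∃ k : ℕ, l i = k + 1
    · obtain ⟨k, hk⟩ := hl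
      refine ⟨k + 1, fun t ht => f_genWS (hc l) t ?_⟩
      rw [hk]
      intro h
      have : k = t := by exact_mod_cast add_right_cancel h
      omega
    · refine ⟨0, fun t _ => f_genWS (hc l) t ?_⟩
      intro h; exact hl ⟨t, h⟩
  choose! N hN using this
  refine ⟨s.sup N, fun t ht => ?_⟩
  rw [Finset.smul_sum]
  exact Finset.sum_eq_zero fun l hl => hN l hl t ((Finset.le_sup hl).trans ht)

lemma Good.ND_bot {lam : Fin n → K} (h : Good K n M (orbitOf K n lam)) {D : Set (Fin n)}
    (hD : ¬ D ⊆ DD K n lam) : ND K M D = ⊥ := by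
  obtain ⟨i, hi, hi'⟩ := Set.not_subset.1 hD
  rw [eq_bot_iff]
  intro x hx
  have hA : x ∈ Asub K M i := by
    have := (Submodule.mem_iInf _).1 hx i
    simpa [Csub, hi] using this
  refine AB_zero hA ?_
  intro t
  obtain ⟨s, c, hs, hc, rfl⟩ := h.exists_sum x
  rw [Finset.smul_sum]
  refine Finset.sum_eq_zero fun l hl => f_genWS (hc l) t ?_
  intro he
  obtain ⟨z, hz⟩ := hs l hl i
  apply hi'
  refine ⟨t + 1 - z, ?_⟩
  push_cast
  rw [← hz, he]; ring

end Gen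


section Basis

variable {K : Type*} [Field K] [CharZero K] {n : ℕ}
  {M : Type*} [AddCommGroup M] [Module K M] [Module (In K n) M] [IsScalarTower K (In K n) M]

/-- `g_i(z) = ∫^z` or `∂^{-z}`. -/
noncomputable def g (K : Type*) [Field K] [CharZero K] {n : ℕ} (i : Fin n) (z : ℤ) : In K n :=
  intEl K n i ^ z.toNat * dEl K n i ^ (-z).toNat

lemma g_zero (i : Fin n) : g K i 0 = 1 := by simp [g]

lemma d_g (i : Fin n) (z : ℤ) : dEl K n i * g K i z = g K i (z - 1) := by
  unfold g
  rcases le_or_gt z 0 with h | h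
  · have h1 : z.toNat = 0 := by omega
    have h2 : (z - 1).toNat = 0 := by omega
    have h3 : (-(z-1)).toNat = (-z).toNat + 1 := by omega
    rw [h1, h2, h3, pow_zero, one_mul, one_mul, pow_succ']
  · have h1 : z.toNat = (z-1).toNat + 1 := by omega
    have h2 : (-z).toNat = 0 := by omega
    have h3 : (-(z-1)).toNat = 0 := by omega
    rw [h1, h2, h3, pow_zero, mul_one, mul_one, pow_succ', ← mul_assoc, d_int, one_mul]

lemma int_g_nonneg (i : Fin n) (z : ℤ) (h : 0 ≤ z) : intEl K n i * g K i z = g K i (z + 1) := by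
  unfold g
  have h1 : (z+1).toNat = z.toNat + 1 := by omega
  have h2 : (-z).toNat = 0 := by omega
  have h3 : (-(z+1)).toNat = 0 := by omega
  rw [h1, h2, h3, pow_zero, mul_one, mul_one, pow_succ']

lemma int_g_neg (i : Fin n) (z : ℤ) (h : z < 0) :
    intEl K n i * g K i z = intEl K n i * dEl K n i * g K i (z + 1) := by
  unfold g
  have h1 : (z+1).toNat = 0 := by omega
  have h2 : z.toNat = 0 := by omega
  have h3 : (-z).toNat = (-(z+1)).toNat + 1 := by omega
  rw [h1, h2, h3, pow_zero, one_mul, one_mul, mul_assoc, pow_succ']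

lemma H_intpow (i : Fin n) (s : ℕ) :
    HEl K n i * intEl K n i ^ s = intEl K n i ^ s * (HEl K n i + (s : In K n)) := by
  induction s with
  | zero => simp
  | succ s ih =>
    have h0 : (HEl K n i + (s : In K n)) * intEl K n i
        = intEl K n i * (HEl K n i + (s : In K n) + 1) := by
      rw [add_mul, H_int, (Nat.cast_commute s (intEl K n i)).eq]; noncomm_ring
    rw [pow_succ, ← mul_assoc, ih, mul_assoc, h0]
    push_cast
    noncomm_ring

lemma H_dpow (i : Fin n) (s : ℕ) :
    HEl K n i * dEl K n i ^ s = dEl K n i ^ s * (HEl K n i - (s : In K n)) := by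
  induction s with
  | zero => simp
  | succ s ih =>
    have h0 : (HEl K n i - (s : In K n)) * dEl K n i
        = dEl K n i * (HEl K n i - (s : In K n) - 1) := by
      rw [sub_mul, H_d, (Nat.cast_commute s (dEl K n i)).eq]; noncomm_ring
    rw [pow_succ, ← mul_assoc, ih, mul_assoc, h0]
    push_cast
    noncomm_ring

lemma H_g (i : Fin n) (z : ℤ) : HEl K n i * g K i z = g K i z * (HEl K n i + (z : In K n)) := by
  unfold g
  rcases le_or_gt z 0 with h | h
  · have h1 : z.toNat = 0 := by omega
    have h2 : (z : In K n) = - (((-z).toNat : ℕ) : In K n) := by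
      rw [← Int.cast_natCast, ← Int.cast_neg]; congr 1; omega
    rw [h1, pow_zero, one_mul, H_dpow, h2, sub_eq_add_neg]
  · have h1 : (-z).toNat = 0 := by omega
    have h2 : (z : In K n) = ((z.toNat : ℕ) : In K n) := by
      rw [← Int.cast_natCast]; congr 1; omega
    rw [h1, pow_zero, mul_one, H_intpow, h2]

lemma g_commute {i : Fin n} {b : In K n} (z : ℤ) (h1 : Commute b (dEl K n i))
    (h2 : Commute b (intEl K n i)) : Commute b (g K i z) :=
  (h2.pow_right _).mul_right (h1.pow_right _)

lemma d_cg {i j : Fin n} (h : i ≠ j) (z : ℤ) : Commute (dEl K n i) (g K j z) :=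
  g_commute z (cd_d i j) (cd_int h)

lemma int_cg {i j : Fin n} (h : i ≠ j) (z : ℤ) : Commute (intEl K n i) (g K j z) :=
  g_commute z (cd_int h.symm).symm (cint_int i j)

lemma H_cg {i j : Fin n} (h : i ≠ j) (z : ℤ) : Commute (HEl K n i) (g K j z) :=
  g_commute z (cH_d h) (cH_int h)

lemma g_cg {i j : Fin n} (h : i ≠ j) (z w : ℤ) : Commute (g K i z) (g K j w) :=
  g_commute w (d_cg h.symm z).symm (int_cg h.symm z).symm

lemma g_pairwise (a : Fin n → ℤ) (s : Set (Fin n)) :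
    s.Pairwise (Function.onFun Commute (fun i => g K i (a i))) :=
  fun _ _ _ _ h => g_cg h _ _

/-- `∏_i g_i(a_i)`. -/
noncomputable def G (K : Type*) [Field K] [CharZero K] {n : ℕ} (a : Fin n → ℤ) : In K n :=
  Finset.univ.noncommProd (fun i => g K i (a i)) (g_pairwise a _)

/-- `∏_{j ≠ i} g_j(a_j)`. -/
noncomputable def GR (K : Type*) [Field K] [CharZero K] {n : ℕ} (i : Fin n) (a : Fin n → ℤ) :
    In K n :=
  (Finset.univ.erase i).noncommProd (fun i => g K i (a i)) (g_pairwise a _)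

lemma G_eq (i : Fin n) (a : Fin n → ℤ) : G K a = g K i (a i) * GR K i a :=
  (Finset.mul_noncommProd_erase _ (Finset.mem_univ i) _ _ _).symm

lemma GR_update (i : Fin n) (a : Fin n → ℤ) (z : ℤ) :
    GR K i (Function.update a i z) = GR K i a := by
  unfold GR
  apply Finset.noncommProd_congr rfl
  intro j hj
  rw [Function.update_of_ne (Finset.ne_of_mem_erase hj)]

lemma G_update (i : Fin n) (a : Fin n → ℤ) (z : ℤ) :
    G K (Function.update a i z) = g K i z * GR K i a := by
  rw [G_eq i, GR_update, Function.update_self]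

lemma GR_comm {i : Fin n} {b : In K n} (a : Fin n → ℤ)
    (h : ∀ j, i ≠ j → ∀ z, Commute b (g K j z)) : Commute b (GR K i a) :=
  Finset.noncommProd_commute _ _ _ _ fun j hj => h j (Finset.ne_of_mem_erase hj).symm _

lemma G_zero : G K (0 : Fin n → ℤ) = 1 := by
  unfold G
  exact (Finset.noncommProd_eq_pow_card _ _ _ 1 (fun i _ => by simpa using g_zero i)).trans
    (one_pow _)

/-- Generating "highest weight" data. -/
structure HW (D : Set (Fin n)) (mu : Fin n → K) (v : M) : Prop where
  ne : v ≠ 0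
  wt : ∀ i, HEl K n i • v = mu i • v
  nil : ∀ i ∈ D, dEl K n i • v = 0
  inv : ∀ i ∉ D, ∀ m : M, (intEl K n i * dEl K n i) • m = m
  gen : Submodule.span (In K n) {v} = ⊤

/-- index set -/
def J (D : Set (Fin n)) : Set (Fin n → ℤ) := {a | ∀ i ∈ D, 0 ≤ a i}

/-- the basis vectors -/
noncomputable def W (K : Type*) [Field K] [CharZero K] {n : ℕ}
    {M : Type*} [AddCommGroup M] [Module (In K n) M]
    (D : Set (Fin n)) (v : M) (a : Fin n → ℤ) : M :=
  open Classical in if a ∈ J D then G K a • v else 0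

lemma W_pos {D : Set (Fin n)} (v : M) {a : Fin n → ℤ} (h : a ∈ J D) : W K D v a = G K a • v :=
  if_pos h

lemma W_neg {D : Set (Fin n)} (v : M) {a : Fin n → ℤ} (h : a ∉ J D) : W K D v a = 0 :=
  if_neg h

variable {D : Set (Fin n)} {mu : Fin n → K} {v : M}

lemma J_update {i : Fin n} {a : Fin n → ℤ} {z : ℤ} (h : a ∈ J D) (hz : i ∈ D → 0 ≤ z) :
    Function.update a i z ∈ J D := by
  intro j hj
  by_cases hij : j = i
  · subst hij; simpa using hz hj
  · rw [Function.update_of_ne hij]; exact h j hj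

lemma HW.d_W (h : HW D mu v) (i : Fin n) (a : Fin n → ℤ) :
    dEl K n i • W K D v a = W K D v (Function.update a i (a i - 1)) := by
  by_cases ha : a ∈ J D
  · rw [W_pos v ha]
    by_cases hi : i ∈ D ∧ a i = 0
    · have h0 : Function.update a i (a i - 1) ∉ J D := by
        intro hc
        have := hc i hi.1
        rw [Function.update_self, hi.2] at this
        omega
      rw [W_neg v h0, G_eq i, hi.2, g_zero, one_mul,
        comm_smul (GR_comm a fun j hj z => d_cg hj z), h.nil i hi.1, smul_zero]
    · have h0 : Function.update a i (a i - 1) ∈ J D := by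
        apply J_update ha
        intro hiD
        have := ha i hiD
        have : a i ≠ 0 := fun h => hi ⟨hiD, h⟩
        omega
      rw [W_pos v h0, G_update, ← d_g, ← mul_smul, G_eq i, mul_assoc]
  · have h0 : Function.update a i (a i - 1) ∉ J D := by
      intro hc
      apply ha
      intro j hj
      have := hc j hj
      by_cases hij : j = i
      · subst hij; rw [Function.update_self] at this; omega
      · rwa [Function.update_of_ne hij] at this
    rw [W_neg v ha, W_neg v h0, smul_zero]

lemma HW.int_W (h : HW D mu v) (i : Fin n) (a : Fin n → ℤ) (ha : a ∈ J D) :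
    intEl K n i • W K D v a = W K D v (Function.update a i (a i + 1)) := by
  have h0 : Function.update a i (a i + 1) ∈ J D := by
    apply J_update ha
    intro hiD
    have := ha i hiD
    omega
  rw [W_pos v ha, W_pos v h0, G_update, G_eq i, ← mul_smul, ← mul_assoc]
  rcases le_or_gt 0 (a i) with hz | hz
  · rw [int_g_nonneg i _ hz]
  · have hi : i ∉ D := fun hc => by have := ha i hc; omega
    rw [int_g_neg i _ hz, mul_assoc, mul_smul _ (_ * _), h.inv i hi]

lemma HW.H_W (h : HW D mu v) (i : Fin n) (a : Fin n → ℤ) :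
    HEl K n i • W K D v a = (mu i + a i) • W K D v a := by
  by_cases ha : a ∈ J D
  · rw [W_pos v ha, G_eq i, ← mul_smul, ← mul_assoc, H_g, mul_assoc, mul_smul, add_mul, add_smul,
      mul_smul, comm_smul (GR_comm a fun j hj z => H_cg hj z), h.wt i]
    have : ((a i : ℤ) : In K n) = algebraMap K (In K n) ((a i : ℤ) : K) := by simp
    rw [smul_comm, this, mul_smul, algebraMap_smul, ← add_smul, mul_smul, smul_comm]
  · rw [W_neg v ha, smul_zero, smul_zero]

lemma HW.x_W (h : HW D mu v) (i : Fin n) (a : Fin n → ℤ) (ha : a ∈ J D) :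
    xEl K n i • W K D v a = (mu i + a i) • W K D v (Function.update a i (a i + 1)) := by
  rw [x_eq, mul_smul, h.H_W, smul_comm, h.int_W i a ha]

lemma W_zero (D : Set (Fin n)) (v : M) : W K D v 0 = v := by
  have h0 : (0 : Fin n → ℤ) ∈ J D := fun i _ => le_rfl
  rw [W_pos v h0, G_zero, one_smul]

lemma HW.W_ne (h : HW D mu v) : ∀ (k : ℕ) (a : Fin n → ℤ), a ∈ J D → (∑ i, (a i).natAbs) = k →
    W K D v a ≠ 0 := by
  intro k
  induction k with
  | zero =>
    intro a ha hk
    have : a = 0 := by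
      ext i
      have := (Finset.sum_eq_zero_iff.1 hk) i (Finset.mem_univ i)
      simpa using this
    rw [this, W_zero]; exact h.ne
  | succ k ih =>
    intro a ha hk h0
    have : ∃ i, a i ≠ 0 := by
      by_contra! hc
      simp [hc] at hk
    obtain ⟨i, hi⟩ := this
    have hsum : ∀ z : ℤ, z.natAbs + 1 = (a i).natAbs →
        ∑ j, (Function.update a i z j).natAbs = k := by
      intro z hz
      rw [← Finset.add_sum_erase _ _ (Finset.mem_univ i)] at hk ⊢
      have : ∑ j ∈ Finset.univ.erase i, (Function.update a i z j).natAbs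
          = ∑ j ∈ Finset.univ.erase i, (a j).natAbs := by
        apply Finset.sum_congr rfl
        intro j hj
        rw [Function.update_of_ne (Finset.ne_of_mem_erase hj)]
      rw [this, Function.update_self]
      omega
    rcases lt_or_gt_of_ne hi with hz | hz
    · have hiD : i ∉ D := fun hc => by have := ha i hc; omega
      refine ih (Function.update a i (a i + 1)) (J_update ha fun hc => absurd hc hiD)
        (hsum _ (by omega)) ?_
      rw [← h.int_W i a ha, h0, smul_zero]
    · refine ih (Function.update a i (a i - 1)) (J_update ha fun hc => by omega)
        (hsum _ (by omega)) ?_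
      rw [← h.d_W i a, h0, smul_zero]

lemma HW.li (h : HW D mu v) : LinearIndependent K (fun a : J D => W K D v a.1) := by
  have hinj : Function.Injective (fun (a : J D) (i : Fin n) => mu i + ((a.1 i : ℤ) : K)) := by
    intro a b hab
    apply Subtype.ext
    funext i
    have := congrFun hab i
    simpa using this
  refine ((genWS_indep K n M).comp hinj).linearIndependent _ ?_ (fun a => h.W_ne _ a.1 a.2 rfl)
  intro a
  refine ⟨1, fun i => ?_⟩
  rw [pow_one, sub_smul, h.H_W, algebraMap_smul, sub_self]

lemma HW.sp (h : HW D mu v) : ⊤ ≤ Submodule.span K (Set.range (fun a : J D => W K D v a.1)) := by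
  set S := Submodule.span K (Set.range (fun a : J D => W K D v a.1)) with hS
  have hmem : ∀ a, W K D v a ∈ S := by
    intro a
    by_cases ha : a ∈ J D
    · exact Submodule.subset_span ⟨⟨a, ha⟩, rfl⟩
    · rw [W_neg v ha]; exact S.zero_mem
  have key : ∀ b : In K n, (∀ a ∈ J D, b • W K D v a ∈ S) → ∀ m ∈ S, b • m ∈ S := by
    intro b hb m hm
    induction hm using Submodule.span_induction with
    | mem x hx => obtain ⟨a, rfl⟩ := hx; exact hb a.1 a.2
    | zero => rw [smul_zero]; exact S.zero_mem
    | add x y _ _ hx hy => rw [smul_add]; exact S.add_mem hx hy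
    | smul c x _ hx => rw [smul_comm]; exact S.smul_mem c hx
  let T := mkSub S
    (fun i => key _ fun a ha => by rw [h.x_W i a ha]; exact S.smul_mem _ (hmem _))
    (fun i => key _ fun a ha => by rw [h.d_W i a]; exact hmem _)
    (fun i => key _ fun a ha => by rw [h.int_W i a ha]; exact hmem _)
  have hT : T = ⊤ := by
    rw [eq_top_iff, ← h.gen, Submodule.span_le, Set.singleton_subset_iff]
    show v ∈ S
    rw [← W_zero (K := K) D v]; exact hmem 0
  intro m _
  have : m ∈ T := by rw [hT]; trivial
  exact this

/-- The basis. -/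
noncomputable def HW.basis (h : HW D mu v) : Module.Basis (J D) K M := Module.Basis.mk h.li h.sp

lemma HW.basis_apply (h : HW D mu v) (a : J D) : h.basis a = W K D v a.1 :=
  Module.Basis.mk_apply h.li h.sp a

end Basis

section OneVar

variable {K : Type*} [Field K] [CharZero K]

lemma HW_P : HW (K := K) (n := 1) (M := P K 1) Set.univ (fun _ => 1) (1 : P K 1) where
  ne := one_ne_zero
  wt := by
    intro i
    have := H_mon (K := K) i (0 : Fin 1 →₀ ℕ)
    simpa using this
  nil := by
    intro i _
    rw [dEl_smul]; simp
  inv := by intro i hi; simp at hi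
  gen := by
    rw [eq_top_iff]
    intro p _
    induction p using MvPolynomial.induction_on with
    | C a =>
      have : (MvPolynomial.C a : P K 1) = (algebraMap K (In K 1) a) • (1 : P K 1) := by
        rw [algebraMap_smul, MvPolynomial.smul_eq_C_mul, mul_one]
      rw [this]
      exact Submodule.smul_mem _ _ (Submodule.mem_span_singleton_self _)
    | add p q hp hq => exact Submodule.add_mem _ (hp trivial) (hq trivial)
    | mul_X p i hp =>
      rw [mul_comm, ← xEl_smul]
      exact Submodule.smul_mem _ _ (hp trivial)

lemma eEl1_eq (s t : ℕ) : eEl1 K s t = intEl K 1 0 ^ s * (e0 K 0 * dEl K 1 0 ^ t) := by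
  rw [eEl1, e0, pow_succ, pow_succ']
  noncomm_ring

lemma F_mem (t : ℕ) : e0 K 0 * dEl K 1 0 ^ t ∈ Fideal K := by
  have : e0 K 0 * dEl K 1 0 ^ t = eEl1 K 0 t := by rw [eEl1_eq, pow_zero, one_mul]
  rw [this]
  exact Submodule.subset_span ⟨0, t, rfl⟩

lemma F_right (a : In K 1) : ∀ t : ℕ, e0 K 0 * dEl K 1 0 ^ t * a ∈ Fideal K := by
  let N : Submodule K (In K 1) :=
    { carrier := {a | ∀ t : ℕ, e0 K 0 * dEl K 1 0 ^ t * a ∈ Fideal K}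
      add_mem' := by
        intro a b ha hb t
        rw [mul_add]; exact Submodule.add_mem _ (ha t) (hb t)
      zero_mem' := by intro t; rw [mul_zero]; exact Submodule.zero_mem _
      smul_mem' := by
        intro c a ha t
        rw [mul_smul_comm, K_smul_eq (n := 1)]
        exact Submodule.smul_mem _ _ (ha t) }
  have h1 : (1 : In K 1) ∈ N := by
    intro t; rw [mul_one]; exact F_mem t
  have := stable_of_gens N ?_ ?_ ?_ a 1 h1
  · rw [smul_eq_mul, mul_one] at this; exact this
  · intro i m hm t
    obtain rfl := Subsingleton.elim i 0
    rw [smul_eq_mul]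
    cases t with
    | zero => rw [pow_zero, mul_one, ← mul_assoc, e0_x, zero_mul]; exact Submodule.zero_mem _
    | succ t =>
      have : e0 K 0 * dEl K 1 0 ^ (t+1) * (xEl K 1 0 * m)
          = ((t : In K 1) + 1) • (e0 K 0 * dEl K 1 0 ^ t * m) := by
        rw [mul_assoc, ← mul_assoc _ (xEl K 1 0), dpow_x, add_mul, mul_add, mul_assoc (xEl K 1 0),
          ← mul_assoc (e0 K 0) (xEl K 1 0), e0_x, zero_mul, zero_add, smul_eq_mul,
          ← mul_assoc, ← mul_assoc, ← mul_assoc, ← mul_assoc]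
        congr 2
        exact ((Nat.cast_commute t (e0 K 0)).add_left (Commute.one_left _)).eq.symm
      rw [this]
      exact Submodule.smul_mem _ _ (hm t)
  · intro i m hm t
    obtain rfl := Subsingleton.elim i 0
    have := hm (t+1)
    rwa [pow_succ, ← mul_assoc, mul_assoc _ (dEl K 1 0)] at this
  · intro i m hm t
    obtain rfl := Subsingleton.elim i 0
    rw [smul_eq_mul]
    cases t with
    | zero => rw [pow_zero, mul_one, ← mul_assoc, e0_int, zero_mul]; exact Submodule.zero_mem _
    | succ t =>
      rw [← mul_assoc, mul_assoc (e0 K 0), dpow_int]; exact hm t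

lemma Msl_e0 (mu : K) (m : Msl K 1 mu) : e0 K (0 : Fin 1) • m = 0 := by
  obtain ⟨a, rfl⟩ := Submodule.Quotient.mk_surjective _ m
  refine (Submodule.Quotient.mk_eq_zero _).2 (Submodule.mem_sup_left ?_)
  have := F_right a 0
  rwa [pow_zero, mul_one] at this

lemma F_kill (f : In K 1) (hf : f ∈ Fideal K) :
    ∃ N0 : ℕ, ∀ N ≥ N0, f * intEl K 1 0 ^ N = 0 := by
  induction hf using Submodule.span_induction with
  | mem x hx =>
    obtain ⟨s, t, rfl⟩ := hx
    refine ⟨t + 1, fun N hN => ?_⟩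
    obtain ⟨k, rfl⟩ := Nat.exists_eq_add_of_le hN
    rw [eEl1_eq, pow_add, pow_succ, mul_assoc, mul_assoc (e0 K 0), ← mul_assoc (dEl K 1 0 ^ t),
      ← mul_assoc (dEl K 1 0 ^ t), dpow_intpow, one_mul, ← mul_assoc (e0 K 0), e0_int]
    simp
  | zero => exact ⟨0, fun N _ => zero_mul _⟩
  | add x y _ _ hx hy =>
    obtain ⟨a, ha⟩ := hx
    obtain ⟨b, hb⟩ := hy
    exact ⟨max a b, fun N hN => by
      rw [add_mul, ha N (le_trans (le_max_left _ _) hN), hb N (le_trans (le_max_right _ _) hN),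
        add_zero]⟩
  | smul c x _ hx =>
    obtain ⟨a, ha⟩ := hx
    exact ⟨a, fun N hN => by rw [smul_eq_mul, mul_assoc, ha N hN, mul_zero]⟩

/-- coefficient functional. -/
noncomputable def Lc (m : ℕ) (p : P K 1) : K := MvPolynomial.constantCoeff (dEl K 1 0 ^ m • p)

lemma cc_int (p : P K 1) : MvPolynomial.constantCoeff (intEl K 1 0 • p) = 0 := by
  induction p using MvPolynomial.induction_on' with
  | monomial α c =>
    have : (MvPolynomial.monomial α c : P K 1) = c • MvPolynomial.monomial α (1:K) := by
      rw [MvPolynomial.smul_monomial, smul_eq_mul, mul_one]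
    rw [this, smul_K_comm, int_mon, MvPolynomial.constantCoeff_smul,
      MvPolynomial.constantCoeff_smul, MvPolynomial.constantCoeff_monomial, if_neg]
    · simp
    · intro h
      have := DFunLike.congr_fun h 0
      simp at this
  | add p q hp hq => rw [smul_add, map_add, hp, hq, add_zero]

lemma d_one : dEl K 1 0 • (1 : P K 1) = 0 := by
  rw [dEl_smul]; simp

lemma Lc_u (m N : ℕ) : Lc m (intEl K 1 0 ^ N • (1 : P K 1)) = if m = N then 1 else 0 := by
  unfold Lc
  rcases lt_trichotomy m N with h | h | h
  · rw [if_neg h.ne]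
    obtain ⟨k, rfl⟩ := Nat.exists_eq_add_of_lt h
    rw [add_assoc, pow_add, ← mul_smul, ← mul_assoc, dpow_intpow, one_mul, pow_succ', mul_smul,
      cc_int]
  · rw [if_pos h, h, ← mul_smul, dpow_intpow, one_smul, map_one]
  · rw [if_neg h.ne']
    obtain ⟨k, rfl⟩ := Nat.exists_eq_add_of_lt h
    rw [add_assoc, add_comm, pow_add, ← mul_smul, mul_assoc, dpow_intpow, mul_one, pow_succ,
      mul_smul, d_one, smul_zero, map_zero]

lemma Lc_d (m : ℕ) (p : P K 1) : Lc m (dEl K 1 0 • p) = Lc (m+1) p := by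
  unfold Lc; rw [← mul_smul, ← pow_succ]

lemma Lc_int (m : ℕ) (p : P K 1) : Lc (m+1) (intEl K 1 0 • p) = Lc m p := by
  unfold Lc; rw [← mul_smul, dpow_int]

lemma Lc_x (m : ℕ) (p : P K 1) : Lc (m+1) (xEl K 1 0 • p) = ((m:K)+1) * Lc m p := by
  unfold Lc
  have : ((m : In K 1) + 1) = algebraMap K (In K 1) ((m:K)+1) := by simp
  rw [← mul_smul, dpow_x, add_smul, mul_smul, map_add, xEl_smul, map_mul,
    MvPolynomial.constantCoeff_X, zero_mul, zero_add, this, mul_smul, algebraMap_smul,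
    MvPolynomial.constantCoeff_smul, smul_eq_mul]

lemma Lc_add (m : ℕ) (p q : P K 1) : Lc m (p + q) = Lc m p + Lc m q := by
  unfold Lc; rw [smul_add, map_add]

lemma Lc_smul (m : ℕ) (c : K) (p : P K 1) : Lc m (c • p) = c * Lc m p := by
  unfold Lc; rw [smul_K_comm, MvPolynomial.constantCoeff_smul, smul_eq_mul]

/-- polynomial growth of matrix coefficients -/
def QP (a : In K 1) : Prop := ∀ j : ℤ, ∃ (p : Polynomial K) (N0 : ℕ), ∀ N ≥ N0, ∀ m : ℕ,
  (m : ℤ) = N + j → Lc m (a • intEl K 1 0 ^ N • (1 : P K 1)) = p.eval (N : K)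

lemma QP_all (a : In K 1) : QP a := by
  let S : Submodule K (In K 1) :=
    { carrier := {a | QP a}
      add_mem' := by
        intro a b ha hb j
        obtain ⟨p, A, hA⟩ := ha j
        obtain ⟨q, B, hB⟩ := hb j
        refine ⟨p + q, max A B, fun N hN m hm => ?_⟩
        rw [add_smul, Lc_add, hA N (le_trans (le_max_left _ _) hN) m hm,
          hB N (le_trans (le_max_right _ _) hN) m hm, Polynomial.eval_add]
      zero_mem' := by
        intro j
        refine ⟨0, 0, fun N _ m _ => ?_⟩
        rw [zero_smul]; simp [Lc]
      smul_mem' := by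
        intro c a ha j
        obtain ⟨p, A, hA⟩ := ha j
        refine ⟨Polynomial.C c * p, A, fun N hN m hm => ?_⟩
        rw [smul_assoc, Lc_smul, hA N hN m hm, Polynomial.eval_mul, Polynomial.eval_C] }
  have h1 : (1 : In K 1) ∈ S := by
    intro j
    by_cases hj : j = 0
    · refine ⟨1, 0, fun N _ m hm => ?_⟩
      rw [one_smul, Lc_u, if_pos (by omega), Polynomial.eval_one]
    · refine ⟨0, 0, fun N _ m hm => ?_⟩
      rw [one_smul, Lc_u, if_neg (by omega), Polynomial.eval_zero]
  have := stable_of_gens S ?_ ?_ ?_ a 1 h1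
  · rw [smul_eq_mul, mul_one] at this; exact this
  · intro i a ha j
    obtain rfl := Subsingleton.elim i 0
    obtain ⟨p, A, hA⟩ := ha (j-1)
    refine ⟨(Polynomial.X + Polynomial.C (j:K)) * p, max A (1-j).toNat, fun N hN m hm => ?_⟩
    have h2 : N ≥ A := le_trans (le_max_left _ _) hN
    have h3 : (1-j).toNat ≤ N := le_trans (le_max_right _ _) hN
    obtain ⟨m, rfl⟩ : ∃ m', m = m' + 1 := ⟨m - 1, by omega⟩
    rw [smul_eq_mul, mul_smul, Lc_x, hA N h2 m (by push_cast at hm; omega), Polynomial.eval_mul]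
    have : ((m:K)+1) = N + j := by exact_mod_cast congrArg (Int.cast (R := K)) hm
    rw [this]; simp
  · intro i a ha j
    obtain rfl := Subsingleton.elim i 0
    obtain ⟨p, A, hA⟩ := ha (j+1)
    refine ⟨p, A, fun N hN m hm => ?_⟩
    rw [smul_eq_mul, mul_smul, Lc_d, hA N hN (m+1) (by push_cast; omega)]
  · intro i a ha j
    obtain rfl := Subsingleton.elim i 0
    obtain ⟨p, A, hA⟩ := ha (j-1)
    refine ⟨p, max A (1-j).toNat, fun N hN m hm => ?_⟩
    have h2 : N ≥ A := le_trans (le_max_left _ _) hN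
    have h3 : (1-j).toNat ≤ N := le_trans (le_max_right _ _) hN
    obtain ⟨m, rfl⟩ : ∃ m', m = m' + 1 := ⟨m - 1, by omega⟩
    rw [smul_eq_mul, mul_smul, Lc_int, hA N h2 m (by push_cast at hm; omega)]

lemma one_notMem (mu : K) : (1 : In K 1) ∉ MslIdeal K 1 mu := by
  intro h
  obtain ⟨f, hf, y, hy, e⟩ := Submodule.mem_sup.1 h
  obtain ⟨a, rfl⟩ := Submodule.mem_span_singleton.1 hy
  obtain ⟨A, hA⟩ := F_kill f hf
  obtain ⟨p, B, hB⟩ := QP_all a 0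
  have key : ∀ N ≥ max A B, ((Polynomial.X + Polynomial.C (1 - mu)) * p - 1).eval (N : K) = 0 := by
    intro N hN
    have h2 : N ≥ A := le_trans (le_max_left _ _) hN
    have h3 : N ≥ B := le_trans (le_max_right _ _) hN
    have e2 : intEl K 1 0 ^ N • (1 : P K 1)
        = ((N:K) + 1 - mu) • (a • intEl K 1 0 ^ N • (1 : P K 1)) := by
      conv_lhs => rw [← one_mul (intEl K 1 0 ^ N), ← e, add_mul, hA N h2, zero_add]
      have hwt : (HEl K 1 0) • (1 : P K 1) = (1 : P K 1) := by
        have := HW_P (K := K).wt 0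
        simpa using this
      have hN' : ((N : In K 1)) = algebraMap K (In K 1) (N:K) := by simp
      have : (HEl K 1 0 - algebraMap K (In K 1) mu) • intEl K 1 0 ^ N • (1 : P K 1)
          = ((N:K) + 1 - mu) • (intEl K 1 0 ^ N • (1 : P K 1)) := by
        rw [sub_smul, algebraMap_smul, ← mul_smul, H_intpow, mul_smul, add_smul, hwt, hN',
          algebraMap_smul, smul_add, smul_K_comm, sub_smul, add_smul, one_smul, add_comm]
      rw [pow_one, smul_eq_mul, mul_smul, mul_smul, this, smul_K_comm]
    have e3 := congrArg (Lc N) e2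
    rw [Lc_u, if_pos rfl, Lc_smul, hB N h3 N (by simp)] at e3
    rw [Polynomial.eval_sub, Polynomial.eval_mul, Polynomial.eval_one]
    simp only [Polynomial.eval_add, Polynomial.eval_X, Polynomial.eval_C]
    linear_combination -e3
  have hz : ((Polynomial.X + Polynomial.C (1 - mu)) * p - 1) = 0 := by
    apply Polynomial.eq_zero_of_infinite_isRoot
    refine Set.Infinite.mono (s := (fun N : ℕ => (N : K)) '' Set.Ici (max A B)) ?_ ?_
    · rintro _ ⟨N, hN, rfl⟩
      exact key N hN
    · exact (Set.Ici_infinite _).image (Nat.cast_injective.injOn)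
  have := congrArg (Polynomial.eval (mu - 1)) hz
  simp at this

/-- The generator of `M(1,mu)`. -/
noncomputable def mslOne (mu : K) : Msl K 1 mu := Submodule.Quotient.mk (p := MslIdeal K 1 mu) (1 : In K 1)

lemma HW_Msl (mu : K) : HW (K := K) (n := 1) (M := Msl K 1 mu) ∅ (fun _ => mu) (mslOne mu) where
  ne := fun h => one_notMem mu ((Submodule.Quotient.mk_eq_zero _).1 h)
  wt := by
    intro i
    obtain rfl := Subsingleton.elim i 0
    rw [K_smul_eq (n := 1), ← sub_eq_zero, ← sub_smul]
    refine (Submodule.Quotient.mk_eq_zero _).2 (Submodule.mem_sup_right ?_)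
    show (HEl K 1 0 - algebraMap K (In K 1) mu) * 1 ∈ _
    rw [pow_one, mul_one]
    exact Submodule.mem_span_singleton_self _
  nil := by intro i hi; exact absurd hi (Set.notMem_empty i)
  inv := by
    intro i _ m
    obtain rfl := Subsingleton.elim i 0
    have := Msl_e0 mu m
    rw [e0, sub_smul, one_smul, sub_eq_zero] at this
    exact this.symm
  gen := by
    rw [eq_top_iff]
    intro m _
    obtain ⟨a, rfl⟩ := Submodule.Quotient.mk_surjective _ m
    refine Submodule.mem_span_singleton.2 ⟨a, ?_⟩
    show Submodule.Quotient.mk (p := MslIdeal K 1 mu) (a • (1 : In K 1)) = _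
    rw [smul_eq_mul, mul_one]

end OneVar

section Realize

universe u

variable {K : Type u} [Field K] [CharZero K] {n : ℕ}

lemma tprodMap_tprod (Mi : Fin n → ModN K 1) (i : Fin n) (b : In K 1)
    (f : ∀ j, (Mi j).carrier) :
    tprodMap K n Mi i b (PiTensorProduct.tprod K f)
      = PiTensorProduct.tprod K (Function.update f i (b • f i)) := by
  unfold tprodMap
  rw [PiTensorProduct.map_tprod]
  congr 1
  funext j
  by_cases h : j = i
  · subst h
    rw [Function.update_self, Function.update_self]; rfl
  · rw [Function.update_of_ne h, Function.update_of_ne h]; rfl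

variable {M : Type*} [AddCommGroup M] [Module K M] [Module (In K n) M] [IsScalarTower K (In K n) M]
  {D : Set (Fin n)} {mu : Fin n → K} {v : M}

/-- index equivalence -/
def Jequiv (D : Set (Fin n)) (E : Fin n → Set (Fin 1)) (hE : ∀ j, 0 ∈ E j ↔ j ∈ D) :
    J D ≃ (∀ j, J (E j)) where
  toFun a j := ⟨fun _ => a.1 j, fun i hi => by
    obtain rfl := Subsingleton.elim i 0
    exact a.2 j ((hE j).1 hi)⟩
  invFun b := ⟨fun j => (b j).1 0, fun j hj => (b j).2 0 ((hE j).2 hj)⟩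
  left_inv a := rfl
  right_inv b := by
    funext j
    apply Subtype.ext
    funext i
    obtain rfl := Subsingleton.elim i 0
    rfl

lemma realizes_tensor (h : HW D mu v) (Mi : Fin n → ModN K 1) (E : Fin n → Set (Fin 1))
    (hE : ∀ j, 0 ∈ E j ↔ j ∈ D) (w : ∀ j, (Mi j).carrier)
    (hw : ∀ j, HW (K := K) (E j) (fun _ => mu j) (w j)) : RealizesTensor K n Mi M := by
  classical
  let B := Basis.piTensorProduct (fun j => (hw j).basis)
  let φ := h.basis.equiv B (Jequiv D E hE)
  have hφ : ∀ a, φ (W K D v a)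
      = PiTensorProduct.tprod K (fun j => W K (E j) (w j) (fun _ => a j)) := by
    intro a
    by_cases ha : a ∈ J D
    · have h1 : W K D v a = h.basis ⟨a, ha⟩ := (h.basis_apply ⟨a, ha⟩).symm
      rw [h1, Module.Basis.equiv_apply, Basis.piTensorProduct_apply]
      congr 1
      funext j
      rw [HW.basis_apply]; rfl
    · rw [W_neg v ha, map_zero]
      have : ∃ j ∈ D, a j < 0 := by
        by_contra! hc
        exact ha hc
      obtain ⟨j, hj, hj'⟩ := this
      refine ((PiTensorProduct.tprod K).map_coord_zero j ?_).symm
      apply W_neg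
      intro hc
      have : 0 ≤ a j := hc 0 ((hE j).2 hj)
      omega
  have hJ : ∀ a ∈ J D, ∀ j, (fun _ : Fin 1 => a j) ∈ J (E j) := by
    intro a ha j i hi
    obtain rfl := Subsingleton.elim i 0
    exact ha j ((hE j).1 hi)
  have key : ∀ (i : Fin n) (b : In K n) (b' : In K 1),
      (∀ a ∈ J D, φ (b • W K D v a) = tprodMap K n Mi i b' (φ (W K D v a))) →
      ∀ m, φ (b • m) = tprodMap K n Mi i b' (φ m) := by
    intro i b b' hb m
    have : φ.toLinearMap ∘ₗ (DistribSMul.toLinearMap K M b)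
        = tprodMap K n Mi i b' ∘ₗ φ.toLinearMap := by
      apply h.basis.ext
      intro a
      rw [h.basis_apply]
      exact hb a.1 a.2
    exact LinearMap.congr_fun this m
  have upd : ∀ (a : Fin n → ℤ) (i : Fin n) (z : ℤ),
      (fun j => W K (E j) (w j) (fun _ => Function.update a i z j))
      = Function.update (fun j => W K (E j) (w j) (fun _ => a j)) i
        (W K (E i) (w i) (Function.update (fun _ => a i) 0 z)) := by
    intro a i z
    funext j
    by_cases hji : j = i
    · subst hji
      rw [Function.update_self, Function.update_self]
      congr 1
      funext t
      obtain rfl := Subsingleton.elim t 0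
      rw [Function.update_self]
    · rw [Function.update_of_ne hji, Function.update_of_ne hji]
  refine ⟨φ, fun i m => ⟨?_, ?_, ?_⟩⟩
  · refine key i _ _ (fun a ha => ?_) m
    rw [h.x_W i a ha, map_smul, hφ, hφ, tprodMap_tprod, upd,
      (hw i).x_W 0 _ (hJ a ha i), MultilinearMap.map_update_smul]
  · refine key i _ _ (fun a ha => ?_) m
    rw [h.d_W i a, hφ, hφ, tprodMap_tprod, upd, (hw i).d_W 0 _]
  · refine key i _ _ (fun a ha => ?_) m
    rw [h.int_W i a ha, hφ, hφ, tprodMap_tprod, upd, (hw i).int_W 0 _ (hJ a ha i)]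

lemma realizes_MD (h : HW D mu v) (lam : Fin n → K) (h1 : ∀ i ∈ D, mu i = 1)
    (h2 : ∀ i ∉ D, mu i = lam i) : RealizesMD K n lam D M := by
  have hex : ∀ j, ∃ Mj : ModN K 1, (j ∈ D → Nonempty (Mj.carrier ≃ₗ[In K 1] P K 1)) ∧
      (j ∉ D → Nonempty (Mj.carrier ≃ₗ[In K 1] Msl K 1 (lam j))) ∧
      ∃ (E : Set (Fin 1)) (w : Mj.carrier), (0 ∈ E ↔ j ∈ D) ∧
        HW (K := K) E (fun _ => mu j) w := by
    intro j
    by_cases hj : j ∈ D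
    · refine ⟨⟨P K 1⟩, fun _ => ⟨LinearEquiv.refl _ _⟩, fun h => absurd hj h, Set.univ,
        (1 : P K 1), by simp [hj], ?_⟩
      rw [h1 j hj]; exact HW_P
    · refine ⟨⟨Msl K 1 (lam j)⟩, fun h => absurd h hj, fun _ => ⟨LinearEquiv.refl _ _⟩, ∅,
        mslOne (lam j), by simp [hj], ?_⟩
      rw [h2 j hj]; exact HW_Msl _
  choose Mi hA hB E w hE hw using hex
  exact ⟨Mi, hA, hB, realizes_tensor h Mi E hE w hw⟩

end Realize

section FindV

variable {K : Type*} [Field K] [CharZero K] {n : ℕ}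
  {M : Type*} [AddCommGroup M] [Module K M] [Module (In K n) M] [IsScalarTower K (In K n) M]

lemma exists_min_pow (a : In K n) {m : M} (hm : m ≠ 0) (h : ∃ N : ℕ, a ^ N • m = 0) :
    ∃ s : ℕ, a ^ s • m ≠ 0 ∧ a • a ^ s • m = 0 := by
  classical
  have h1 := Nat.find_spec h
  have h2 : Nat.find h ≠ 0 := by
    intro h0
    rw [h0, pow_zero, one_smul] at h1
    exact hm h1
  obtain ⟨s, hs⟩ := Nat.exists_eq_succ_of_ne_zero h2
  refine ⟨s, Nat.find_min h (by omega), ?_⟩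
  rw [← mul_smul, ← pow_succ']
  rwa [hs] at h1

lemma Hc_comm (i j : Fin n) (c d : K) :
    Commute (HEl K n i - algebraMap K (In K n) c) (HEl K n j - algebraMap K (In K n) d) := by
  have h1 : Commute (HEl K n i) (HEl K n j) := hEl_comm K n i j
  exact Commute.sub_left (Commute.sub_right h1 (Algebra.commutes d (HEl K n i)).symm)
    (Algebra.commutes c _)

lemma exists_eigen (l : Fin n → K) {m : M} (hm : m ≠ 0) (hg : m ∈ genWeightSpace K n M l)
    (s : Finset (Fin n)) :
    ∃ m' : M, m' ≠ 0 ∧ m' ∈ genWeightSpace K n M l ∧ ∀ i ∈ s, HEl K n i • m' = l i • m' := by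
  induction s using Finset.induction_on with
  | empty => exact ⟨m, hm, hg, by simp⟩
  | insert j s _ ih =>
    obtain ⟨m', h0, ⟨N, hN⟩, hs⟩ := ih
    obtain ⟨t, ht, ht'⟩ := exists_min_pow (HEl K n j - algebraMap K (In K n) (l j)) h0 ⟨N, hN j⟩
    refine ⟨_, ht, ⟨N, fun i => ?_⟩, ?_⟩
    · rw [comm_smul (((Hc_comm i j (l i) (l j)).pow_left N).pow_right t), hN i, smul_zero]
    · intro i hi
      rw [K_smul_eq (n := n), ← sub_eq_zero, ← sub_smul]
      rcases Finset.mem_insert.1 hi with rfl | hi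
      · exact ht'
      · have : (HEl K n i - algebraMap K (In K n) (l i)) • m' = 0 := by
          rw [sub_smul, ← K_smul_eq, hs i hi, sub_self]
        rw [comm_smul ((Hc_comm i j (l i) (l j)).pow_right t), this, smul_zero]

lemma int_inj (i : Fin n) (a : ℕ) {m : M} (h : intEl K n i ^ a • m = 0) : m = 0 := by
  have := congrArg (fun y => dEl K n i ^ a • y) h
  simpa only [← mul_smul, dpow_intpow, one_smul, smul_zero] using this

lemma d_inj (i : Fin n) (hinv : ∀ m : M, (intEl K n i * dEl K n i) • m = m) (b : ℕ) {m : M}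
    (h : dEl K n i ^ b • m = 0) : m = 0 := by
  induction b with
  | zero => simpa using h
  | succ b ih =>
    apply ih
    rw [pow_succ', mul_smul] at h
    rw [← hinv (dEl K n i ^ b • m), mul_smul, h, smul_zero]

lemma shift_wt {l : Fin n → K} {m : M} (hm : ∀ i, HEl K n i • m = l i • m) (j : Fin n) (z : ℤ) :
    ∀ i, HEl K n i • g K j z • m = (Function.update l j (l j + z)) i • g K j z • m := by
  intro i
  by_cases h : i = j
  · subst h
    have : ((z : ℤ) : In K n) = algebraMap K (In K n) ((z : ℤ) : K) := by simp
    rw [Function.update_self, ← mul_smul, H_g, mul_smul, add_smul, hm, this, algebraMap_smul,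
      ← add_smul, smul_comm]
  · rw [Function.update_of_ne h, comm_smul (H_cg h z), hm, smul_comm]

lemma exists_adjust (D : Set (Fin n)) (lam : Fin n → K)
    (hA : ∀ i ∈ D, ∀ m : M, m ∈ Asub K M i)
    (hB : ∀ i ∉ D, ∀ m : M, (intEl K n i * dEl K n i) • m = m)
    {m : M} (hm : m ≠ 0) {l : Fin n → K} (hl : l ∈ orbitOf K n lam)
    (hw : ∀ i, HEl K n i • m = l i • m) (s : Finset (Fin n)) :
    ∃ (m' : M) (l' : Fin n → K), m' ≠ 0 ∧ l' ∈ orbitOf K n lam ∧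
      (∀ i, HEl K n i • m' = l' i • m') ∧ (∀ i ∈ s, i ∈ D → dEl K n i • m' = 0) ∧
      (∀ i ∈ s, i ∉ D → l' i = lam i) := by
  induction s using Finset.induction_on with
  | empty => exact ⟨m, l, hm, hl, hw, by simp, by simp⟩
  | insert j s hj ih =>
    obtain ⟨m', l', h0, hl', hw', h1, h2⟩ := ih
    have main : ∀ z : ℤ, g K j z • m' ≠ 0 → (j ∈ D → dEl K n j • g K j z • m' = 0) →
        (j ∉ D → l' j + z = lam j) → ∃ (m' : M) (l' : Fin n → K), m' ≠ 0 ∧ l' ∈ orbitOf K n lam ∧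
      (∀ i, HEl K n i • m' = l' i • m') ∧ (∀ i ∈ insert j s, i ∈ D → dEl K n i • m' = 0) ∧
      (∀ i ∈ insert j s, i ∉ D → l' i = lam i) := by
      intro z hz hd hl2
      refine ⟨_, _, hz, ?_, shift_wt hw' j z, ?_, ?_⟩
      · intro i
        obtain ⟨y, hy⟩ := hl' i
        by_cases h : i = j
        · subst h
          refine ⟨y + z, ?_⟩
          rw [Function.update_self]; push_cast; linear_combination hy
        · refine ⟨y, ?_⟩
          rw [Function.update_of_ne h]; exact hy
      · intro i hi hiD
        by_cases h : i = j
        · subst h; exact hd hiD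
        · rw [comm_smul (d_cg h z), h1 i (Finset.mem_of_mem_insert_of_ne hi h) hiD, smul_zero]
      · intro i hi hiD
        by_cases h : i = j
        · subst h; rw [Function.update_self]; exact hl2 hiD
        · rw [Function.update_of_ne h]; exact h2 i (Finset.mem_of_mem_insert_of_ne hi h) hiD
    by_cases hjD : j ∈ D
    · obtain ⟨t, ht, ht'⟩ := exists_min_pow (dEl K n j) h0 (hA j hjD m')
      have hg : g K j (-(t:ℤ)) = dEl K n j ^ t := by
        unfold g
        have e1 : (-(t:ℤ)).toNat = 0 := by omega
        have e2 : (- -(t:ℤ)).toNat = t := by omega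
        rw [e1, e2, pow_zero, one_mul]
      exact main (-(t:ℤ)) (by rwa [hg]) (fun _ => by rwa [hg]) (fun h => absurd hjD h)
    · obtain ⟨y, hy⟩ := hl' j
      refine main (-y) ?_ (fun h => absurd h hjD) (fun _ => by push_cast; linear_combination hy)
      intro hz
      unfold g at hz
      rw [mul_smul] at hz
      exact h0 (d_inj j (hB j hjD) _ (int_inj j _ hz))

lemma exists_HW (D : Set (Fin n)) (lam : Fin n → K) (hs : IsSimpleModule (In K n) M)
    (hG : Good K n M (orbitOf K n lam))
    (hA : ∀ i ∈ D, ∀ m : M, m ∈ Asub K M i) (hB : ∀ i ∉ D, ∀ m : M, m ∈ Bsub K M i) :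
    ∃ (mu : Fin n → K) (v : M), HW D mu v ∧ (∀ i ∈ D, mu i = 1) ∧ (∀ i ∉ D, mu i = lam i) := by
  have hB' : ∀ i ∉ D, ∀ m : M, (intEl K n i * dEl K n i) • m = m := by
    intro i hi m
    have := hB i hi m 0
    rw [pow_zero, mul_one, e0, sub_smul, one_smul, sub_eq_zero] at this
    exact this.symm
  haveI := IsSimpleModule.nontrivial (In K n) M
  obtain ⟨x, hx⟩ := exists_ne (0 : M)
  obtain ⟨s, c, hs1, hc, rfl⟩ := hG.exists_sum x
  obtain ⟨l, hl, hl0⟩ := Finset.exists_ne_zero_of_sum_ne_zero hx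
  obtain ⟨m, hm, _, hw⟩ := exists_eigen l hl0 (hc l) Finset.univ
  obtain ⟨v, mu, h0, _, hw', h1, h2⟩ := exists_adjust D lam hA hB' hm (hs1 l hl)
    (fun i => hw i (Finset.mem_univ i)) Finset.univ
  refine ⟨mu, v, ⟨h0, hw', fun i => h1 i (Finset.mem_univ i), hB', ?_⟩, ?_,
    fun i => h2 i (Finset.mem_univ i)⟩
  · rcases eq_bot_or_eq_top (Submodule.span (In K n) {v}) with h | h
    · exact absurd (Submodule.span_singleton_eq_bot.1 h) h0
    · exact h
  · intro i hi
    have e := hw' i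
    rw [H_eq, add_smul, mul_smul, h1 i (Finset.mem_univ i) hi, smul_zero, zero_add, one_smul] at e
    have e2 : (mu i - 1) • v = 0 := by rw [sub_smul, one_smul, ← e, sub_self]
    rcases smul_eq_zero.1 e2 with h | h
    · exact sub_eq_zero.1 h
    · exact absurd h h0

end FindV

section Final

universe u

variable {K : Type u} [Field K] [CharZero K] {n : ℕ}

section maps

variable {M : Type*} [AddCommGroup M] [Module K M] [Module (In K n) M] [IsScalarTower K (In K n) M]
  {M' : Type*} [AddCommGroup M'] [Module K M'] [Module (In K n) M'] [IsScalarTower K (In K n) M']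

lemma Asub_map (f : M →ₗ[In K n] M') {i : Fin n} {m : M} (h : m ∈ Asub K M i) :
    f m ∈ Asub K M' i := by
  obtain ⟨k, hk⟩ := mem_Asub.1 h
  exact mem_Asub.2 ⟨k, by rw [← map_smul, hk, map_zero]⟩

lemma Bsub_map (f : M →ₗ[In K n] M') {i : Fin n} {m : M} (h : m ∈ Bsub K M i) :
    f m ∈ Bsub K M' i := by
  rw [mem_Bsub] at h ⊢
  intro s
  rw [← map_smul, h s, map_zero]

lemma Asub_inj (f : M →ₗ[In K n] M') (hf : Function.Injective f) {i : Fin n} {m : M}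
    (h : f m ∈ Asub K M' i) : m ∈ Asub K M i := by
  obtain ⟨k, hk⟩ := mem_Asub.1 h
  exact mem_Asub.2 ⟨k, hf (by rw [map_smul, hk, map_zero])⟩

lemma Bsub_inj (f : M →ₗ[In K n] M') (hf : Function.Injective f) {i : Fin n} {m : M}
    (h : f m ∈ Bsub K M' i) : m ∈ Bsub K M i := by
  rw [mem_Bsub] at h ⊢
  intro s
  exact hf (by rw [map_smul, h s, map_zero])

end maps

variable {M : Type*} [AddCommGroup M] [Module K M] [Module (In K n) M] [IsScalarTower K (In K n) M]
  {D : Set (Fin n)} {lam : Fin n → K}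

lemma mem_ND_A {x : M} (h : x ∈ ND K M D) {i : Fin n} (hi : i ∈ D) : x ∈ Asub K M i := by
  have := (Submodule.mem_iInf _).1 h i
  unfold Csub at this
  rwa [if_pos hi] at this

lemma mem_ND_B {x : M} (h : x ∈ ND K M D) {i : Fin n} (hi : i ∉ D) : x ∈ Bsub K M i := by
  have := (Submodule.mem_iInf _).1 h i
  unfold Csub at this
  rwa [if_neg hi] at this

lemma inGWD_ND (h : Good K n M (orbitOf K n lam)) : InGWD K n lam D (ND K M D) := by
  have hX := h.sub (ND K M D)
  refine ⟨Good.isGen K n _ hX, Good.supp K n _ hX, ?_⟩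
  intro p q _ hs
  have hq := hX.sub q
  have hS := hq.surj (Submodule.mkQ (Submodule.comap q.subtype p)) (Submodule.mkQ_surjective _)
  suffices hh : ∃ (mu : Fin n → K) (v : q ⧸ Submodule.comap q.subtype p),
      HW D mu v ∧ (∀ i ∈ D, mu i = 1) ∧ (∀ i ∉ D, mu i = lam i) by
    obtain ⟨mu, v, hv, h1, h2⟩ := hh
    exact realizes_MD hv lam h1 h2
  apply exists_HW D lam hs hS
  · intro i hi m
    obtain ⟨x, rfl⟩ := Submodule.mkQ_surjective _ m
    apply Asub_map
    apply Asub_inj q.subtype (Submodule.injective_subtype q)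
    apply Asub_inj (ND K M D).subtype (Submodule.injective_subtype _)
    exact mem_ND_A x.1.2 hi
  · intro i hi m
    obtain ⟨x, rfl⟩ := Submodule.mkQ_surjective _ m
    apply Bsub_map
    apply Bsub_inj q.subtype (Submodule.injective_subtype q)
    apply Bsub_inj (ND K M D).subtype (Submodule.injective_subtype _)
    exact mem_ND_B x.1.2 hi

lemma P_Asub (p : P K 1) : p ∈ Asub K (P K 1) (0 : Fin 1) := by
  have h : Asub K (P K 1) (0 : Fin 1) = ⊤ := by
    rw [eq_top_iff, ← HW_P.gen, Submodule.span_le, Set.singleton_subset_iff]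
    exact ⟨1, by rw [pow_one, d_one]⟩
  rw [h]; trivial

lemma tprodMap_iter (Mi : Fin n → ModN K 1) (i : Fin n) (b : In K 1) (k : ℕ)
    (f : ∀ j, (Mi j).carrier) :
    (tprodMap K n Mi i b)^[k] (PiTensorProduct.tprod K f)
      = PiTensorProduct.tprod K (Function.update f i (b ^ k • f i)) := by
  induction k with
  | zero => simp
  | succ k ih =>
    rw [Function.iterate_succ_apply', ih, tprodMap_tprod, Function.update_self,
      Function.update_idem, ← mul_smul, ← pow_succ']

lemma iter_add {V : Type*} [AddCommGroup V] [Module K V] (T : V →ₗ[K] V) {k l : ℕ} (hle : k ≤ l)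
    {x : V} (h : T^[k] x = 0) : T^[l] x = 0 := by
  obtain ⟨t, rfl⟩ := Nat.exists_eq_add_of_le hle
  rw [add_comm, Function.iterate_add_apply, h]
  induction t with
  | zero => rfl
  | succ t ih => rw [Function.iterate_succ_apply, map_zero]; exact ih (by omega)

lemma realizes_A (h : RealizesMD K n lam D M) {i : Fin n} (hi : i ∈ D) (m : M) :
    m ∈ Asub K M i := by
  obtain ⟨Mi, hA, hB, φ, hφ⟩ := h
  obtain ⟨ψ⟩ := hA i hi
  have hnil : ∀ y : (Mi i).carrier, ∃ k : ℕ, dEl K 1 0 ^ k • y = 0 := by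
    intro y
    exact Asub_inj (K := K) ψ.toLinearMap ψ.injective (P_Asub (ψ y))
  set T := tprodMap K n Mi i (dEl K 1 0) with hT
  have key : ∀ t, ∃ k : ℕ, T^[k] t = 0 := by
    intro t
    induction t using PiTensorProduct.induction_on with
    | smul_tprod r f =>
      obtain ⟨k, hk⟩ := hnil (f i)
      refine ⟨k, ?_⟩
      rw [← Module.End.coe_pow, map_smul, Module.End.coe_pow, hT, tprodMap_iter, hk,
        (PiTensorProduct.tprod K).map_coord_zero i (by rw [Function.update_self]), smul_zero]
    | add x y hx hy =>
      obtain ⟨k, hk⟩ := hx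
      obtain ⟨l, hl⟩ := hy
      refine ⟨max k l, ?_⟩
      have h1 := iter_add T (le_max_left k l) hk
      have h2 := iter_add T (le_max_right k l) hl
      rw [← Module.End.coe_pow] at h1 h2 ⊢
      rw [map_add, h1, h2, add_zero]
  have hpow : ∀ k : ℕ, ∀ m : M, φ (dEl K n i ^ k • m) = T^[k] (φ m) := by
    intro k
    induction k with
    | zero => intro m; simp
    | succ k ih =>
      intro m
      rw [pow_succ', mul_smul, (hφ i _).2.1, ih, Function.iterate_succ_apply']
  obtain ⟨k, hk⟩ := key (φ m)
  exact ⟨k, φ.injective (by rw [hpow, hk, map_zero])⟩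

lemma realizes_B (h : RealizesMD K n lam D M) {i : Fin n} (hi : i ∉ D) (m : M) :
    m ∈ Bsub K M i := by
  obtain ⟨Mi, hA, hB, φ, hφ⟩ := h
  obtain ⟨ψ⟩ := hB i hi
  have hinv : ∀ y : (Mi i).carrier, intEl K 1 0 • dEl K 1 0 • y = y := by
    intro y
    apply ψ.injective
    rw [map_smul, map_smul, ← mul_smul]
    exact (HW_Msl (lam i)).inv 0 (Set.notMem_empty _) _
  have key : ∀ t, tprodMap K n Mi i (intEl K 1 0) (tprodMap K n Mi i (dEl K 1 0) t) = t := by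
    intro t
    induction t using PiTensorProduct.induction_on with
    | smul_tprod r f =>
      rw [map_smul, map_smul, tprodMap_tprod, tprodMap_tprod, Function.update_self,
        Function.update_idem, hinv, Function.update_eq_self]
    | add x y hx hy => rw [map_add, map_add, hx, hy]
  have hinv2 : ∀ m : M, intEl K n i • dEl K n i • m = m := by
    intro m
    apply φ.injective
    rw [(hφ i _).2.2, (hφ i _).2.1, key]
  rw [mem_Bsub]
  intro s
  rw [mul_smul, e0, sub_smul, one_smul, mul_smul, hinv2, sub_self]

lemma exists_simple {R X : Type*} [Ring R] [AddCommGroup X] [Module R X] {z : X} (hz : z ≠ 0) :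
    ∃ p q : Submodule R X, ∃ hzq : z ∈ q, p ≤ q ∧
      IsSimpleModule R (q ⧸ Submodule.comap q.subtype p) ∧
      Submodule.mkQ (Submodule.comap q.subtype p) ⟨z, hzq⟩ ≠ 0 := by
  set q := Submodule.span R {z} with hq
  have hzq : z ∈ q := Submodule.mem_span_singleton_self z
  haveI : Module.Finite R q := Module.Finite.span_singleton R z
  have hgen : ∀ m : Submodule R q, (⟨z, hzq⟩ : q) ∈ m → m = ⊤ := by
    intro m hm
    rw [eq_top_iff]
    rintro ⟨y, hy⟩ _
    obtain ⟨a, rfl⟩ := Submodule.mem_span_singleton.1 hy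
    exact m.smul_mem a hm
  have hne : (⊥ : Submodule R q) ≠ ⊤ := by
    intro h
    have : (⟨z, hzq⟩ : q) ∈ (⊥ : Submodule R q) := by rw [h]; trivial
    rw [Submodule.mem_bot] at this
    exact hz (congrArg Subtype.val this)
  obtain ⟨m, hm, _⟩ := (eq_top_or_exists_le_coatom (⊥ : Submodule R q)).resolve_left hne
  have hc : Submodule.comap q.subtype (m.map q.subtype) = m :=
    Submodule.comap_map_eq_of_injective (Submodule.injective_subtype q) m
  refine ⟨m.map q.subtype, q, hzq, Submodule.map_subtype_le q m, ?_, ?_⟩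
  · rw [hc]; exact isSimpleModule_iff_isCoatom.2 hm
  · rw [hc]
    intro h0
    have := (Submodule.Quotient.mk_eq_zero _).1 h0
    exact hm.1 (hgen m this)

lemma inGWD_zero (h : InGWD K n lam D M) {i : Fin n} {z : M}
    (hz : (i ∈ D ∧ z ∈ Bsub K M i) ∨ (i ∉ D ∧ z ∈ Asub K M i)) : z = 0 := by
  by_contra h0
  obtain ⟨p, q, hzq, hpq, hs, hne⟩ := exists_simple (R := In K n) h0
  have hR := h.2.2 p q hpq hs
  apply hne
  rcases hz with ⟨hi, hz⟩ | ⟨hi, hz⟩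
  · exact AB_zero (K := K) (realizes_A hR hi _)
      (Bsub_map _ (Bsub_inj q.subtype (Submodule.injective_subtype q) hz))
  · exact AB_zero (K := K) (Asub_map _ (Asub_inj q.subtype (Submodule.injective_subtype q) hz))
      (realizes_B hR hi _)

lemma inGWD_Csub (h : InGWD K n lam D M) (x : M) (i : Fin n) : x ∈ Csub K M D i := by
  have hG := good_of K n M _ h.1 h.2.1
  obtain ⟨y, z, -, -, hy, hz, rfl⟩ := AB_split hG.sfin i ⊤ x trivial
  unfold Csub
  by_cases hi : i ∈ D
  · rw [if_pos hi, inGWD_zero h (Or.inl ⟨hi, hz⟩), add_zero]; exact hy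
  · rw [if_neg hi, inGWD_zero h (Or.inr ⟨hi, hy⟩), zero_add]; exact hz

lemma le_ND (N : Submodule (In K n) M) (h : InGWD K n lam D N) : N ≤ ND K M D := by
  intro x hx
  refine (Submodule.mem_iInf _).2 fun i => ?_
  have := inGWD_Csub h ⟨x, hx⟩ i
  unfold Csub at this ⊢
  split_ifs with hi
  · rw [if_pos hi] at this; exact Asub_map N.subtype this
  · rw [if_neg hi] at this; exact Bsub_map N.subtype this

lemma eq_of_le_indep {R X ι : Type*} [Ring R] [AddCommGroup X] [Module R X]
    {A B : ι → Submodule R X} (hle : ∀ i, A i ≤ B i) (hA : iSup A = ⊤) (hB : iSupIndep B) :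
    A = B := by
  funext i
  refine le_antisymm (hle i) ?_
  intro x hx
  have hx' : x ∈ A i ⊔ ⨆ j ≠ i, A j := by
    have : iSup A ≤ A i ⊔ ⨆ j ≠ i, A j := by
      refine iSup_le fun j => ?_
      by_cases h : j = i
      · subst h; exact le_sup_left
      · exact le_sup_of_le_right (le_iSup₂_of_le j h le_rfl)
    exact this (hA ▸ trivial)
  obtain ⟨y, hy, z, hz, rfl⟩ := Submodule.mem_sup.1 hx'
  have hz1 : z ∈ B i := by
    have := (B i).sub_mem hx (hle i hy)
    rwa [add_sub_cancel_left] at this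
  have hz2 : z ∈ ⨆ j ≠ i, B j := (iSup₂_mono fun j _ => hle j) hz
  have := Submodule.disjoint_def.1 (hB i) z hz1 hz2
  rw [this, add_zero]; exact hy

end Final


end Aux

/-- `GW(𝕀_n, Ω) = ⊕_{𝒟_Ω ⊆ 𝔻_Ω} GW(𝕀_n, 𝒟_Ω)`: every generalized weight
module with support in `Ω` decomposes uniquely as a direct sum of submodules lying in the
subcategories `GW(𝕀_n, 𝒟_Ω)`. -/
theorem statement9 (K : Type*) [Field K] [CharZero K] (n : ℕ)
    (lam : Fin n → K) (hnorm : IsNormalized K n lam)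
    (M : Type*) [AddCommGroup M] [Module K M] [Module (In K n) M] [IsScalarTower K (In K n) M]
    (hgw : IsGenWeightModule K n M) (hsupp : supp K n M ⊆ orbitOf K n lam) :
    ∃! N : Set (Fin n) → Submodule (In K n) M,
      (∀ D, ¬ D ⊆ DD K n lam → N D = ⊥) ∧
      (letI := Classical.decEq (Set (Fin n))
       DirectSum.IsInternal N) ∧
      (∀ D : Set (Fin n), InGWD K n lam D (N D)) := by
  have hG := Aux.good_of K n M _ hgw hsupp
  refine ⟨Aux.ND K M, ⟨fun D hD => hG.ND_bot hD, ?_, fun D => Aux.inGWD_ND hG⟩, ?_⟩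
  · exact (Aux.isInternal_iff' (Classical.decEq _) _).2
      ⟨Aux.ND_indep hG.sfin, Aux.ND_top hG.sfin⟩
  · rintro N ⟨-, hN, hD⟩
    have hN' := (Aux.isInternal_iff' (Classical.decEq _) _).1 hN
    exact Aux.eq_of_le_indep (fun D => Aux.le_ND _ (hD D)) hN'.2 (Aux.ND_indep hG.sfin)

end IDO
end

section
/- Let K be an algebraically closed field of characteristic zero, A = K[h_1,h_2]/(h_1^2, h_2^2), 𝔪 = (h_1,h_2) its maximal ideal, and Λ = K[h_1,h_2]/(h_1^2, h_1h_2, h_2^2) = A/𝔪^2. Then the left A-module A is indecomposable and injective, every finite dimensional A-module M with 𝔪^2 M ≠ 0 contains a submodule isomorphic to A, and consequently every finite dimensional indecomposable A-module is either isomorphic to A or is annihilated by 𝔪^2 (i.e., is an indecomposable Λ-module): ind_f(A) = ind_f(Λ) ∪ {A}. -/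
set_option maxHeartbeats 1000000
set_option synthInstance.maxHeartbeats 400000

namespace Stmt19

noncomputable section

variable (K : Type*) [Field K] [CharZero K]

/-- The polynomial ring `K[h_1, h_2]`. -/
abbrev R := MvPolynomial (Fin 2) K

/-- The relations `h_1^2, h_2^2`. -/
def relA : Ideal (R K) := Ideal.span {MvPolynomial.X 0 ^ 2, MvPolynomial.X 1 ^ 2}

/-- `A = K[h_1, h_2]/(h_1^2, h_2^2)`. -/
abbrev A := R K ⧸ relA K

/-- The maximal ideal `𝔪 = (h_1, h_2)` of `A`. -/
def mA : Ideal (A K) :=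
  Ideal.span {Ideal.Quotient.mk (relA K) (MvPolynomial.X 0),
    Ideal.Quotient.mk (relA K) (MvPolynomial.X 1)}

end


section helpers
variable {K : Type*} [Field K]

/-- h_1 -/
noncomputable def hx (K : Type*) [Field K] : A K := Ideal.Quotient.mk (relA K) (MvPolynomial.X 0)
/-- h_2 -/
noncomputable def hy (K : Type*) [Field K] : A K := Ideal.Quotient.mk (relA K) (MvPolynomial.X 1)

lemma hx_sq : hx K * hx K = 0 := by
  unfold hx
  rw [← map_mul, Ideal.Quotient.eq_zero_iff_mem, ← sq]
  exact Ideal.subset_span (by simp)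

lemma hy_sq : hy K * hy K = 0 := by
  unfold hy
  rw [← map_mul, Ideal.Quotient.eq_zero_iff_mem, ← sq]
  exact Ideal.subset_span (by simp)

/-- evaluation in iterated dual numbers -/
noncomputable def ev0 (K : Type*) [Field K] :
    MvPolynomial (Fin 2) K →ₐ[K] DualNumber (DualNumber K) :=
  MvPolynomial.aeval (R := K) (S₁ := DualNumber (DualNumber K))
    (![TrivSqZeroExt.inl DualNumber.eps, DualNumber.eps] : Fin 2 → DualNumber (DualNumber K))

/-- evaluation on the quotient -/
noncomputable def ev (K : Type*) [Field K] : A K →ₐ[K] DualNumber (DualNumber K) :=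
  Ideal.Quotient.liftₐ (relA K) (ev0 K) (by
    intro a ha
    have : relA K ≤ RingHom.ker (ev0 K) := by
      unfold relA
      rw [Ideal.span_le]
      rintro p (rfl | rfl)
      · simp [ev0, RingHom.mem_ker, sq, ← TrivSqZeroExt.inl_mul]
      · simp [ev0, RingHom.mem_ker, sq]
    exact this ha)

lemma ev_x : ev K (hx K) = TrivSqZeroExt.inl DualNumber.eps := by
  change ev0 K (MvPolynomial.X 0) = _
  simp [ev0]

lemma ev_y : ev K (hy K) = DualNumber.eps := by
  change ev0 K (MvPolynomial.X 1) = _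
  simp [ev0]

/-- the socle functional -/
noncomputable def ep (K : Type*) [Field K] : A K →ₗ[K] K where
  toFun a := (ev K a).snd.snd
  map_add' a b := by simp
  map_smul' c a := by simp

lemma ep_one : ep K 1 = 0 := by simp [ep]
lemma ep_x : ep K (hx K) = 0 := by simp [ep, ev_x]
lemma ep_y : ep K (hy K) = 0 := by simp [ep, ev_y]
lemma ep_xy : ep K (hx K * hy K) = 1 := by simp [ep, ev_x, ev_y]

lemma exists_rep (a : A K) : ∃ c0 c1 c2 c3 : K,
    a = c0 • 1 + c1 • hx K + c2 • hy K + c3 • (hx K * hy K) := by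
  obtain ⟨p, rfl⟩ := Ideal.Quotient.mk_surjective a
  induction p using MvPolynomial.induction_on with
  | C c =>
    refine ⟨c, 0, 0, 0, ?_⟩
    simp only [zero_smul, add_zero]
    rw [← Algebra.algebraMap_eq_smul_one]
    rfl
  | add p q hp hq =>
    obtain ⟨a0, a1, a2, a3, ha⟩ := hp
    obtain ⟨b0, b1, b2, b3, hb⟩ := hq
    refine ⟨a0 + b0, a1 + b1, a2 + b2, a3 + b3, ?_⟩
    rw [map_add, ha, hb]
    module
  | mul_X p i hp =>
    obtain ⟨a0, a1, a2, a3, ha⟩ := hp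
    rw [map_mul, ha]
    have h1 := hx_sq (K := K)
    have h2 := hy_sq (K := K)
    fin_cases i
    · refine ⟨0, a0, 0, a2, ?_⟩
      change _ * hx K = _
      simp only [add_mul, smul_mul_assoc, one_mul, h1, mul_right_comm (hx K) (hy K) (hx K),
        zero_mul, mul_comm (hy K) (hx K)]
      module
    · refine ⟨0, 0, a0, a1, ?_⟩
      change _ * hy K = _
      simp only [add_mul, smul_mul_assoc, one_mul, h2, mul_assoc, mul_zero]
      module

lemma rep (a : A K) : a = ep K (hx K * hy K * a) • 1 + ep K (hy K * a) • hx K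
    + ep K (hx K * a) • hy K + ep K a • (hx K * hy K) := by
  obtain ⟨c0, c1, c2, c3, h⟩ := exists_rep a
  have h1 := hx_sq (K := K)
  have h2 := hy_sq (K := K)
  have e3 : ep K a = c3 := by simp [h, ep_one, ep_x, ep_y, ep_xy]
  have e2 : ep K (hx K * a) = c2 := by
    have : hx K * a = c0 • hx K + c2 • (hx K * hy K) := by
      rw [h]
      simp only [mul_add, mul_smul_comm, mul_one, h1, ← mul_assoc, zero_mul, smul_zero, add_zero]
    simp [this, ep_x, ep_xy]
  have e1 : ep K (hy K * a) = c1 := by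
    have : hy K * a = c0 • hy K + c1 • (hx K * hy K) := by
      rw [h]
      simp only [mul_add, mul_smul_comm, mul_one, h2, mul_left_comm (hy K) (hx K) (hy K),
        mul_zero, smul_zero, add_zero, mul_comm (hy K) (hx K)]
    simp [this, ep_y, ep_xy]
  have e0 : ep K (hx K * hy K * a) = c0 := by
    have : hx K * hy K * a = c0 • (hx K * hy K) := by
      rw [h]
      simp only [mul_add, mul_smul_comm, mul_one, mul_assoc, h2, mul_left_comm (hy K) (hx K) (hy K),
        mul_zero, smul_zero, add_zero, mul_right_comm (hx K) (hy K) (hx K), mul_comm (hy K) (hx K)]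
      simp only [← mul_assoc, h1, zero_mul, smul_zero, add_zero]
    simp [this, ep_xy]
  rw [e0, e1, e2, e3]
  exact h

lemma ext_ep {a b : A K} (h : ∀ c, ep K (c * a) = ep K (c * b)) : a = b := by
  rw [rep a, rep b, h, h, h]
  have := h 1
  rw [one_mul, one_mul] at this
  rw [this]

lemma isUnit_of (a : A K) (h : ep K (hx K * hy K * a) ≠ 0) : IsUnit a := by
  have h1 := hx_sq (K := K)
  have h2 := hy_sq (K := K)
  rw [rep a, add_assoc, add_assoc]
  have hn : IsNilpotent (ep K (hy K * a) • hx K + (ep K (hx K * a) • hy K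
      + ep K a • (hx K * hy K))) := by
    have nx : IsNilpotent (hx K) := ⟨2, by rw [sq, h1]⟩
    have ny : IsNilpotent (hy K) := ⟨2, by rw [sq, h2]⟩
    have nxy : IsNilpotent (hx K * hy K) := (Commute.all _ _).isNilpotent_mul_right nx
    exact (Commute.all _ _).isNilpotent_add (nx.smul _)
      ((Commute.all _ _).isNilpotent_add (ny.smul _) (nxy.smul _))
  refine hn.isUnit_add_left_of_commute ?_ (Commute.all _ _)
  rw [← Algebra.algebraMap_eq_smul_one]
  exact (IsUnit.mk0 _ h).map (algebraMap K (A K))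

section
variable {M : Type*} [AddCommGroup M] [Module K M] [Module (A K) M] [IsScalarTower K (A K) M]

/-- underlying function of the coinduced map -/
noncomputable def psiFun (φ : M →ₗ[K] K) (n : M) : A K :=
  φ ((hx K * hy K) • n) • 1 + φ (hy K • n) • hx K + φ (hx K • n) • hy K + φ n • (hx K * hy K)

lemma ep_psiFun (φ : M →ₗ[K] K) (n : M) (b : A K) : ep K (b * psiFun φ n) = φ (b • n) := by
  have e : b • n = ep K (hx K * hy K * b) • n + ep K (hy K * b) • hx K • n
    + ep K (hx K * b) • hy K • n + ep K b • (hx K * hy K) • n := by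
    conv_lhs => rw [rep b]
    simp only [add_smul, smul_assoc, one_smul]
  rw [e]
  simp only [psiFun, mul_add, mul_smul_comm, map_add, map_smul, smul_eq_mul, mul_one]
  rw [mul_comm b (hx K), mul_comm b (hy K), mul_comm b (hx K * hy K)]
  ring

/-- coinduced map -/
noncomputable def psi (φ : M →ₗ[K] K) : M →ₗ[A K] A K where
  toFun := psiFun φ
  map_add' a b := ext_ep fun c => by simp only [mul_add, map_add, ep_psiFun, smul_add]
  map_smul' r a := ext_ep fun c => by
    rw [RingHom.id_apply, smul_eq_mul, ← mul_assoc, ep_psiFun, ep_psiFun, mul_smul]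

lemma ep_psi (φ : M →ₗ[K] K) (n : M) (b : A K) : ep K (b * psi φ n) = φ (b • n) :=
  ep_psiFun φ n b

lemma inj_of (m : M) (hm : (hx K * hy K) • m ≠ 0) (a : A K) (ha : a • m = 0) : a = 0 := by
  obtain ⟨φ, hφ⟩ := Module.Projective.exists_dual_ne_zero K hm
  have hu : IsUnit (psi φ m) := isUnit_of _ (by rw [ep_psi]; exact hφ)
  have : a * psi φ m = 0 := by rw [← smul_eq_mul, ← map_smul, ha, map_zero]
  exact (hu.mul_left_eq_zero).1 this

lemma exists_xy (h : (mA K ^ 2) • (⊤ : Submodule (A K) M) ≠ ⊥) :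
    ∃ m : M, (hx K * hy K) • m ≠ 0 := by
  by_contra! hc
  apply h
  rw [eq_bot_iff, Submodule.smul_le]
  have hle : mA K ^ 2 ≤ Ideal.span {hx K * hy K} := by
    rw [sq]
    change Ideal.span {hx K, hy K} * Ideal.span {hx K, hy K} ≤ _
    rw [Ideal.span_pair_mul_span_pair, Ideal.span_le]
    rintro z hz
    simp only [hx_sq, hy_sq, mul_comm (hy K) (hx K), Set.mem_insert_iff,
      Set.mem_singleton_iff] at hz
    rcases hz with rfl | rfl | rfl | rfl
    · exact zero_mem _
    · exact Ideal.mem_span_singleton_self _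
    · exact Ideal.mem_span_singleton_self _
    · exact zero_mem _
  intro r hr n _
  obtain ⟨c, rfl⟩ := Ideal.mem_span_singleton.1 (hle hr)
  rw [mul_smul, hc]
  exact zero_mem _

lemma iso_of (h : (mA K ^ 2) • (⊤ : Submodule (A K) M) ≠ ⊥)
    (hi : ∀ p q : Submodule (A K) M, IsCompl p q → p = ⊥ ∨ q = ⊥) :
    Nonempty (M ≃ₗ[A K] A K) := by
  obtain ⟨m, hm⟩ := exists_xy h
  obtain ⟨φ, hφ⟩ := Module.Projective.exists_dual_ne_zero K hm
  have hu : IsUnit (psi φ m) := isUnit_of _ (by rw [ep_psi]; exact hφ)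
  obtain ⟨v, hv⟩ := hu.exists_left_inv
  have hc : IsCompl (Submodule.span (A K) {m}) (LinearMap.ker (psi φ)) := by
    constructor
    · rw [Submodule.disjoint_def]
      intro z hz hz'
      obtain ⟨a, rfl⟩ := Submodule.mem_span_singleton.1 hz
      rw [LinearMap.mem_ker, map_smul, smul_eq_mul] at hz'
      rw [(hu.mul_left_eq_zero).1 hz', zero_smul]
    · rw [codisjoint_iff, eq_top_iff]
      intro n _
      refine Submodule.mem_sup.2 ⟨(psi φ n * v) • m,
        Submodule.smul_mem _ _ (Submodule.mem_span_singleton_self m),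
        n - (psi φ n * v) • m, ?_, by abel⟩
      rw [LinearMap.mem_ker, map_sub, map_smul, smul_eq_mul, mul_assoc, hv, mul_one, sub_self]
  rcases hi _ _ hc with h0 | h0
  · exfalso
    rw [Submodule.span_singleton_eq_bot] at h0
    exact hm (by rw [h0, smul_zero])
  · refine ⟨LinearEquiv.ofBijective (psi φ) ⟨LinearMap.ker_eq_bot.1 h0, fun a => ?_⟩⟩
    exact ⟨(a * v) • m, by rw [map_smul, smul_eq_mul, mul_assoc, hv, mul_one]⟩

end

lemma injA : Module.Injective (A K) (A K) := by
  apply Module.Baer.injective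
  intro I g
  obtain ⟨φ, hφ⟩ := LinearMap.exists_extend (p := I.restrictScalars K)
    ((ep K).comp (g.restrictScalars K))
  refine ⟨psi φ, fun z hz => ext_ep fun c => ?_⟩
  rw [ep_psi]
  have := LinearMap.congr_fun hφ ⟨c • z, I.smul_mem c hz⟩
  refine this.trans ?_
  change ep K (g (c • ⟨z, hz⟩)) = _
  rw [map_smul, smul_eq_mul]

lemma indecA (p q : Submodule (A K) (A K)) (h : IsCompl p q) : p = ⊥ ∨ q = ⊥ := by
  have h1 : (1 : A K) ∈ p ⊔ q := by rw [h.sup_eq_top]; trivial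
  obtain ⟨e, he, f, hf, hef⟩ := Submodule.mem_sup.1 h1
  by_cases hz : ep K (hx K * hy K * e) = 0
  · left
    have hu : IsUnit f := isUnit_of _ (by
      intro h0
      have : ep K (hx K * hy K * (e + f)) = 0 := by rw [mul_add, map_add, hz, h0, add_zero]
      rw [hef, mul_one, ep_xy] at this
      exact one_ne_zero this)
    have : q = ⊤ := Ideal.eq_top_of_isUnit_mem q hf hu
    subst this
    simpa using h.disjoint
  · right
    have : p = ⊤ := Ideal.eq_top_of_isUnit_mem p he (isUnit_of _ hz)
    subst this
    simpa using h.disjoint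

lemma nontrivA : Nontrivial (A K) :=
  ⟨hx K * hy K, 0, fun h => by
    have := ep_xy (K := K)
    rw [h, map_zero] at this
    exact zero_ne_one this⟩

end helpers

/-- for `A = K[h_1,h_2]/(h_1², h_2²)` (over an algebraically closed field of
characteristic zero) with maximal ideal `𝔪 = (h_1, h_2)`: the `A`-module `A` is
indecomposable and injective; every finite dimensional `A`-module `M` with `𝔪²M ≠ 0`
contains a copy of `A`; consequently every finite dimensional indecomposable `A`-module is
either isomorphic to `A` or annihilated by `𝔪²` (i.e. is an indecomposable module over
`Λ = A/𝔪² = K[h_1,h_2]/(h_1², h_1h_2, h_2²)`): `ind_f(A) = ind_f(Λ) ∪ {A}`. -/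
theorem statement19 (K : Type*) [Field K] [CharZero K] [IsAlgClosed K] :
    (Nontrivial (A K) ∧
      ∀ p q : Submodule (A K) (A K), IsCompl p q → p = ⊥ ∨ q = ⊥) ∧
    Module.Injective (A K) (A K) ∧
    (∀ (M : Type*) [AddCommGroup M] [Module K M] [Module (A K) M] [IsScalarTower K (A K) M],
      FiniteDimensional K M → (mA K ^ 2) • (⊤ : Submodule (A K) M) ≠ ⊥ →
      ∃ f : A K →ₗ[A K] M, Function.Injective f) ∧
    (∀ (M : Type*) [AddCommGroup M] [Module K M] [Module (A K) M] [IsScalarTower K (A K) M],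
      FiniteDimensional K M → Nontrivial M →
      (∀ p q : Submodule (A K) M, IsCompl p q → p = ⊥ ∨ q = ⊥) →
      (Nonempty (M ≃ₗ[A K] A K) ∨ (mA K ^ 2) • (⊤ : Submodule (A K) M) = ⊥)) := by
  refine ⟨⟨nontrivA, indecA⟩, injA, ?_, ?_⟩
  · intro M _ _ _ _ _ h
    obtain ⟨m, hm⟩ := exists_xy h
    refine ⟨LinearMap.toSpanSingleton (A K) M m, ?_⟩
    rw [injective_iff_map_eq_zero]
    intro a ha
    exact inj_of m hm a ha
  · intro M _ _ _ _ _ _ hi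
    by_cases h : (mA K ^ 2) • (⊤ : Submodule (A K) M) = ⊥
    · exact Or.inr h
    · exact Or.inl (iso_of h hi)

end Stmt19
end
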